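/- arXiv:1802.10025 — 7 statements merged into one kernel-verified Lean document; each statement's English description precedes it below -/
import Mathlib

section
/- Let q ≥ 5 be a prime and let G be the dihedral group of order 4q with presentation ⟨r, s | r^{2q} = s² = (sr)² = 1⟩. Suppose g₁, g₂, g₃ ∈ G each have order 2, that g₁, g₂, g₃ generate G, and that the product g₁g₂g₃ has order 2q. Then exactly one of g₁, g₂, g₃ equals the central involution r^q, and the other two are reflections s·r^{e₁} and s·r^{e₂} whose exponents e₁, e₂ have the same parity (i.e., e₁ − e₂ is even). -/
/-- A rotation of order 2 in the dihedral group of order `4n` is the half turn. -/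
theorem DihedralGroup.eq_natCast_of_orderOf_r_eq_two {n : ℕ} {i : ZMod (2 * n)}
    (h : orderOf (DihedralGroup.r i) = 2) : i = (n : ZMod (2 * n)) := by
  obtain ⟨k, rfl⟩ := ZMod.intCast_surjective i
  have hsq := pow_orderOf_eq_one (DihedralGroup.r (k : ZMod (2 * n)))
  rw [h, DihedralGroup.r_pow, DihedralGroup.one_def, DihedralGroup.r.injEq] at hsq
  have hdvd : ((2 * n : ℕ) : ℤ) ∣ k * 2 :=
    (CharP.intCast_eq_zero_iff (ZMod (2 * n)) (2 * n) _).1 (by exact_mod_cast hsq)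
  obtain ⟨m, hm⟩ := hdvd
  push_cast at hm
  have hk : k = n * m := by linarith
  have hzero : ((2 * n : ℕ) : ZMod (2 * n)) = 0 := ZMod.natCast_self _
  push_cast at hzero
  rcases Int.even_or_odd' m with ⟨c, rfl | rfl⟩
  · have : (k : ZMod (2 * n)) = 0 := by
      rw [hk]
      push_cast
      linear_combination (c : ZMod (2 * n)) * hzero
    simp [this] at h
  · rw [hk]
    push_cast
    linear_combination (c : ZMod (2 * n)) * hzero

/-- In the dihedral group of order `4n`, a rotation of order `2n` has odd exponent. -/
theorem DihedralGroup.odd_of_orderOf_r_eq_two_mul {n : ℕ} (hn : n ≠ 0) {k : ℤ}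
    (h : orderOf (DihedralGroup.r (k : ZMod (2 * n))) = 2 * n) : Odd k := by
  rw [← Int.not_even_iff_odd]
  rintro ⟨m, rfl⟩
  have hzero : ((2 * n : ℕ) : ZMod (2 * n)) = 0 := ZMod.natCast_self _
  push_cast at hzero
  have hpow : DihedralGroup.r ((m + m : ℤ) : ZMod (2 * n)) ^ n = 1 := by
    rw [DihedralGroup.r_pow, DihedralGroup.one_def, DihedralGroup.r.injEq]
    push_cast
    linear_combination (m : ZMod (2 * n)) * hzero
  have hle := Nat.le_of_dvd (Nat.pos_of_ne_zero hn) (orderOf_dvd_of_pow_eq_one hpow)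
  omega

/-- For a prime `q ≥ 5` and the dihedral group `G = ⟨r, s | r^(2q) = s² = (sr)² = 1⟩` of
order `4q` (Mathlib's `DihedralGroup (2*q)`): if `g₁, g₂, g₃` are elements of order 2 which
generate `G` and whose product has order `2q`, then exactly one of them is the central
involution `r^q` while the other two are reflections `s·r^(e₁)`, `s·r^(e₂)` with `e₁ − e₂`
even. -/
theorem stmt_2 (q : ℕ) (hq : q.Prime) (hq5 : 5 ≤ q)
    (g₁ g₂ g₃ : DihedralGroup (2*q))
    (h₁ : orderOf g₁ = 2) (h₂ : orderOf g₂ = 2) (h₃ : orderOf g₃ = 2)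
    (hgen : Subgroup.closure ({g₁, g₂, g₃} : Set (DihedralGroup (2*q))) = ⊤)
    (hprod : orderOf (g₁ * g₂ * g₃) = 2*q) :
    ∃ e₁ e₂ : ℤ, Even (e₁ - e₂) ∧
      ((g₁ = DihedralGroup.r ((q : ℕ) : ZMod (2*q)) ∧
        g₂ = DihedralGroup.sr ((e₁ : ℤ) : ZMod (2*q)) ∧
        g₃ = DihedralGroup.sr ((e₂ : ℤ) : ZMod (2*q))) ∨
       (g₂ = DihedralGroup.r ((q : ℕ) : ZMod (2*q)) ∧
        g₁ = DihedralGroup.sr ((e₁ : ℤ) : ZMod (2*q)) ∧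
        g₃ = DihedralGroup.sr ((e₂ : ℤ) : ZMod (2*q))) ∨
       (g₃ = DihedralGroup.r ((q : ℕ) : ZMod (2*q)) ∧
        g₁ = DihedralGroup.sr ((e₁ : ℤ) : ZMod (2*q)) ∧
        g₂ = DihedralGroup.sr ((e₂ : ℤ) : ZMod (2*q)))) := by
  have hq0 : q ≠ 0 := hq.ne_zero
  have hqodd : Odd (q : ℤ) := by exact_mod_cast hq.odd_of_ne_two (by omega)
  have heven (a b c : ℤ) (hc : Odd c)
      (h : orderOf (DihedralGroup.r ((b - a + c : ℤ) : ZMod (2 * q))) = 2 * q) :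
      Even (a - b) := by
    have hodd := DihedralGroup.odd_of_orderOf_r_eq_two_mul hq0 h
    rw [← even_neg, neg_sub]
    simpa using hodd.sub_odd hc
  rcases g₁ with i | i <;> rcases g₂ with j | j <;> rcases g₃ with k | k
  · obtain rfl := DihedralGroup.eq_natCast_of_orderOf_r_eq_two h₁
    obtain rfl := DihedralGroup.eq_natCast_of_orderOf_r_eq_two h₂
    obtain rfl := DihedralGroup.eq_natCast_of_orderOf_r_eq_two h₃
    have hsq := pow_orderOf_eq_one (DihedralGroup.r (q : ZMod (2 * q)))
    rw [h₁, pow_two] at hsq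
    rw [hsq, one_mul, h₁] at hprod
    omega
  · simp at hprod
    omega
  · simp at hprod
    omega
  · obtain rfl := DihedralGroup.eq_natCast_of_orderOf_r_eq_two h₁
    obtain ⟨a, rfl⟩ := ZMod.intCast_surjective j
    obtain ⟨b, rfl⟩ := ZMod.intCast_surjective k
    refine ⟨a, b, heven a b q hqodd ?_, Or.inl ⟨rfl, rfl, rfl⟩⟩
    convert hprod using 2
    simp only [DihedralGroup.r_mul_sr, DihedralGroup.sr_mul_sr, DihedralGroup.r.injEq]
    push_cast
    ring
  · simp at hprod
    omega
  · obtain rfl := DihedralGroup.eq_natCast_of_orderOf_r_eq_two h₂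
    obtain ⟨a, rfl⟩ := ZMod.intCast_surjective i
    obtain ⟨b, rfl⟩ := ZMod.intCast_surjective k
    refine ⟨a, b, heven a b (-q) hqodd.neg ?_, Or.inr (Or.inl ⟨rfl, rfl, rfl⟩)⟩
    convert hprod using 2
    simp only [DihedralGroup.sr_mul_r, DihedralGroup.sr_mul_sr, DihedralGroup.r.injEq]
    push_cast
    ring
  · obtain rfl := DihedralGroup.eq_natCast_of_orderOf_r_eq_two h₃
    obtain ⟨a, rfl⟩ := ZMod.intCast_surjective i
    obtain ⟨b, rfl⟩ := ZMod.intCast_surjective j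
    refine ⟨a, b, heven a b q hqodd ?_, Or.inr (Or.inr ⟨rfl, rfl, rfl⟩)⟩
    convert hprod using 2
    simp only [DihedralGroup.r_mul_r, DihedralGroup.sr_mul_sr, DihedralGroup.r.injEq]
    push_cast
    ring
  · simp at hprod
    omega
end

section
/- Let q ≥ 5 be a prime and let G be the dihedral group of order 4q with presentation ⟨r, s | r^{2q} = s² = (sr)² = 1⟩. Let (g₁, g₂, g₃, g₄) be a generating vector of G of type (2, 2, 2, 2q); that is: g₁, g₂, g₃, g₄ generate G, g₁g₂g₃g₄ = 1, the orders of g₁, g₂, g₃ are 2, and the order of g₄ is 2q. Then there exist integers e₁, e₂ with e₁ − e₂ even and e₁ − e₂ not congruent to 0 modulo 2q, such that the multiset {g₁, g₂, g₃} equals {s·r^{e₁}, s·r^{e₂}, r^q} and g₄ equals r^{e₁−e₂+q} or r^{−(e₁−e₂+q)}. -/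
namespace DihedralGroup

theorem eq_natCast_of_orderOf_r_eq_two_s3 {q : ℕ} [NeZero (2 * q)] {i : ZMod (2 * q)}
    (h : orderOf (r i) = 2) : i = q := by
  have h_two_mul : ((2 * i.val : ℕ) : ZMod (2 * q)) = 0 := by
    have hpow := pow_orderOf_eq_one (r i)
    rw [h, r_pow, one_def, r.injEq] at hpow
    push_cast at hpow ⊢
    rwa [ZMod.natCast_zmod_val, mul_comm (2 : ZMod (2 * q))]
  have h_ne : i.val ≠ 0 := by
    intro h0
    rw [ZMod.val_eq_zero] at h0
    simp [h0] at h
  rw [ZMod.natCast_eq_zero_iff] at h_two_mul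
  obtain ⟨k, hk⟩ := Nat.dvd_of_mul_dvd_mul_left two_pos h_two_mul
  have hlt := i.val_lt
  have hk1 : k = 1 := by
    have hk2 : k < 2 := by
      by_contra! hk2
      nlinarith
    have hk0 : k ≠ 0 := by
      rintro rfl
      simp [hk] at h_ne
    omega
  rw [← ZMod.natCast_zmod_val i, hk, hk1, mul_one]

theorem exists_eq_r_of_two_lt_orderOf {n : ℕ} {g : DihedralGroup n} (h : 2 < orderOf g) :
    ∃ i, g = r i := by
  cases g with
  | r i => exact ⟨i, rfl⟩
  | sr i => simp at h

theorem even_and_not_dvd_of_orderOf_r {q : ℕ} (hq : Odd q) (hq1 : 1 < q) {d : ℤ}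
    (h : orderOf (r (-((d + q : ℤ) : ZMod (2 * q)))) = 2 * q) :
    Even d ∧ ¬ (2 * (q : ℤ)) ∣ d := by
  have not_pow_eq_one {m : ℕ} (hm : 0 < m) (hmq : m < 2 * q) :
      ¬ (2 * (q : ℤ)) ∣ (d + q) * m := by
    intro hdvd
    have hz : (((d + q) * m : ℤ) : ZMod (2 * q)) = 0 :=
      (ZMod.intCast_zmod_eq_zero_iff_dvd _ _).2 (by exact_mod_cast hdvd)
    refine Nat.not_dvd_of_pos_of_lt hm hmq (h ▸ orderOf_dvd_of_pow_eq_one ?_)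
    rw [r_pow, one_def, r.injEq, neg_mul, neg_eq_zero]
    exact_mod_cast hz
  constructor
  · by_contra hd
    have heven : Even (d + q) :=
      (Int.not_even_iff_odd.1 hd).add_odd (by exact_mod_cast hq)
    exact not_pow_eq_one (by omega) (by omega) (mul_dvd_mul_right heven.two_dvd _)
  · rintro ⟨k, rfl⟩
    exact not_pow_eq_one two_pos (by omega) ⟨2 * k + 1, by push_cast; ring⟩

end DihedralGroup


/-- For a prime `q ≥ 5` and the dihedral group `G = ⟨r, s | r^(2q) = s² = (sr)² = 1⟩` of
order `4q` (Mathlib's `DihedralGroup (2*q)`): if `(g₁, g₂, g₃, g₄)` is a generating vector of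
type `(2,2,2,2q)` (i.e. the `gᵢ` generate `G`, `g₁g₂g₃g₄ = 1`, `g₁, g₂, g₃` have order 2 and
`g₄` has order `2q`), then there are integers `e₁, e₂` with `e₁ − e₂` even and
`e₁ − e₂ ≢ 0 (mod 2q)` such that the multiset `{g₁, g₂, g₃}` is `{s·r^(e₁), s·r^(e₂), r^q}`
and `g₄ = r^(e₁−e₂+q)` or `g₄ = r^(−(e₁−e₂+q))`. -/
theorem stmt_3 (q : ℕ) (hq : q.Prime) (hq5 : 5 ≤ q)
    (g₁ g₂ g₃ g₄ : DihedralGroup (2*q))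
    (hgen : Subgroup.closure ({g₁, g₂, g₃, g₄} : Set (DihedralGroup (2*q))) = ⊤)
    (hprod : g₁ * g₂ * g₃ * g₄ = 1)
    (h₁ : orderOf g₁ = 2) (h₂ : orderOf g₂ = 2) (h₃ : orderOf g₃ = 2)
    (h₄ : orderOf g₄ = 2*q) :
    ∃ e₁ e₂ : ℤ, Even (e₁ - e₂) ∧ ¬ ((2*(q : ℤ)) ∣ (e₁ - e₂)) ∧
      ({g₁, g₂, g₃} : Multiset (DihedralGroup (2*q))) =
        {DihedralGroup.sr ((e₁ : ℤ) : ZMod (2*q)),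
         DihedralGroup.sr ((e₂ : ℤ) : ZMod (2*q)),
         DihedralGroup.r ((q : ℕ) : ZMod (2*q))} ∧
      (g₄ = DihedralGroup.r ((e₁ - e₂ + (q : ℤ) : ℤ) : ZMod (2*q)) ∨
       g₄ = DihedralGroup.r (-((e₁ - e₂ + (q : ℤ) : ℤ) : ZMod (2*q)))) := by
  have : NeZero (2 * q) := ⟨by omega⟩
  have hodd : Odd q := hq.odd_of_ne_two (by omega)
  have hqq : (q : ZMod (2 * q)) + q = 0 := by
    have := ZMod.natCast_self (2 * q)
    push_cast at this
    linear_combination this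
  have of_eq {a b : ZMod (2 * q)}
      (hms : ({g₁, g₂, g₃} : Multiset (DihedralGroup (2 * q))) =
        {DihedralGroup.sr b, DihedralGroup.sr a, DihedralGroup.r q})
      (hg : g₄ = DihedralGroup.r (-(b - a + (q : ZMod (2 * q))))) :
      ∃ e₁ e₂ : ℤ, Even (e₁ - e₂) ∧ ¬ ((2*(q : ℤ)) ∣ (e₁ - e₂)) ∧
        ({g₁, g₂, g₃} : Multiset (DihedralGroup (2*q))) =
          {DihedralGroup.sr ((e₁ : ℤ) : ZMod (2*q)),
           DihedralGroup.sr ((e₂ : ℤ) : ZMod (2*q)),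
           DihedralGroup.r ((q : ℕ) : ZMod (2*q))} ∧
        (g₄ = DihedralGroup.r ((e₁ - e₂ + (q : ℤ) : ℤ) : ZMod (2*q)) ∨
         g₄ = DihedralGroup.r (-((e₁ - e₂ + (q : ℤ) : ℤ) : ZMod (2*q)))) := by
    obtain ⟨e₁, rfl⟩ := ZMod.intCast_surjective b
    obtain ⟨e₂, rfl⟩ := ZMod.intCast_surjective a
    have hg' : g₄ = DihedralGroup.r (-((e₁ - e₂ + (q : ℤ) : ℤ) : ZMod (2*q))) := by
      rw [hg]
      push_cast
      rfl
    obtain ⟨heven, hndvd⟩ :=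
      DihedralGroup.even_and_not_dvd_of_orderOf_r hodd (by omega) (hg' ▸ h₄)
    exact ⟨e₁, e₂, heven, hndvd, hms, Or.inr hg'⟩
  obtain ⟨x, rfl⟩ := DihedralGroup.exists_eq_r_of_two_lt_orderOf (g := g₄) (by omega)
  rcases g₁ with a | a <;> rcases g₂ with b | b <;> rcases g₃ with c | c <;>
    simp only [DihedralGroup.r_mul_r, DihedralGroup.r_mul_sr, DihedralGroup.sr_mul_r,
      DihedralGroup.sr_mul_sr, DihedralGroup.one_def, DihedralGroup.r.injEq,
      reduceCtorEq] at hprod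
  · obtain rfl := DihedralGroup.eq_natCast_of_orderOf_r_eq_two_s3 h₁
    obtain rfl := DihedralGroup.eq_natCast_of_orderOf_r_eq_two_s3 h₂
    obtain rfl := DihedralGroup.eq_natCast_of_orderOf_r_eq_two_s3 h₃
    obtain rfl : x = q := by linear_combination hprod - 2 * hqq
    omega
  · obtain rfl := DihedralGroup.eq_natCast_of_orderOf_r_eq_two_s3 h₁
    refine of_eq (a := b) (b := c) ?_ ?_
    · simp only [Multiset.insert_eq_cons, ← Multiset.singleton_add]
      abel
    · rw [DihedralGroup.r.injEq]
      linear_combination hprod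
  · obtain rfl := DihedralGroup.eq_natCast_of_orderOf_r_eq_two_s3 h₂
    refine of_eq (a := a) (b := c) ?_ ?_
    · simp only [Multiset.insert_eq_cons, ← Multiset.singleton_add]
      abel
    · rw [DihedralGroup.r.injEq]
      linear_combination hprod + hqq
  · obtain rfl := DihedralGroup.eq_natCast_of_orderOf_r_eq_two_s3 h₃
    refine of_eq (a := a) (b := b) ?_ ?_
    · simp only [Multiset.insert_eq_cons, ← Multiset.singleton_add]
      abel
    · rw [DihedralGroup.r.injEq]
      linear_combination hprod
end

section
/- Let q ≥ 5 be a prime and let G be the dihedral group of order 4q with presentation ⟨r, s | r^{2q} = s² = (sr)² = 1⟩. Then, up to isomorphism, there are exactly 6 irreducible rational representations of G (equivalently, exactly 6 isomorphism classes of simple modules over the group algebra ℚ[G]): four of ℚ-dimension 1 and two of ℚ-dimension q − 1. -/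
/-- A rational representation of the dihedral group of order `4q`: a module over the group
algebra `ℚ[DihedralGroup (2*q)]`, together with its underlying `ℚ`-vector-space structure
(recorded by the scalar-tower condition). -/
structure QGModule (q : ℕ) where
  carrier : Type
  [isAddCommGroup : AddCommGroup carrier]
  [isModuleRat : Module ℚ carrier]
  [isModule : Module (MonoidAlgebra ℚ (DihedralGroup (2*q))) carrier]
  [isTower : IsScalarTower ℚ (MonoidAlgebra ℚ (DihedralGroup (2*q))) carrier]

attribute [instance] QGModule.isAddCommGroup QGModule.isModuleRat QGModule.isModule
  QGModule.isTower

open MonoidAlgebra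

/-- The data of a dihedral action on a field `K`: a character `χ` of the rotation subgroup of
`DihedralGroup n`, an involution `σ` inverting `χ`, and a sign `δ`, such that the values of `χ`
generate `K`. -/
structure DihedralTwist (n : ℕ) (K : Type) [Field K] [CharZero K] where
  χ : AddChar (ZMod n) K
  σ : K ≃ₐ[ℚ] K
  δ : ℚ
  σ_σ : ∀ x, σ (σ x) = x
  σ_χ : ∀ i, σ (χ i) = χ (-i)
  δ_mul_δ : δ * δ = 1
  adjoin_eq_top : Algebra.adjoin ℚ {χ 1} = ⊤

lemma pow_eq_self_of_odd {M : Type*} [Monoid M] {ε : M} (hε : ε * ε = 1) {k : ℕ} (hk : Odd k) :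
    ε ^ k = ε := by
  obtain ⟨m, rfl⟩ := hk
  rw [pow_succ, pow_mul, sq, hε, one_pow, one_mul]

namespace DihedralTwist

variable {n : ℕ} {K : Type} [Field K] [CharZero K] (D : DihedralTwist n K)

/-- The representation of `DihedralGroup n` on `K` in which `r i` multiplies by `χ i` and `sr 0`
acts as `δ • σ`. -/
noncomputable def rep : Representation ℚ (DihedralGroup n) K where
  toFun
    | .r i => LinearMap.mulLeft ℚ (D.χ i)
    | .sr i => D.δ • D.σ.toLinearMap ∘ₗ LinearMap.mulLeft ℚ (D.χ i)
  map_one' := by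
    rw [DihedralGroup.one_def]
    ext x
    simp
  map_mul' := by
    have hχ (i j : ZMod n) : D.χ (j - i) = D.χ (-i) * D.χ j := by
      rw [← AddChar.map_add_eq_mul]; congr 1; ring
    rintro (i | i) (j | j) <;> refine LinearMap.ext fun x ↦ ?_
    · simp [AddChar.map_add_eq_mul]
    · simp [hχ, D.σ_χ]
    · simp [AddChar.map_add_eq_mul]
    · simp [hχ, D.σ_χ, D.σ_σ, smul_smul, D.δ_mul_δ]

@[simp] lemma rep_r (i : ZMod n) (x : K) : D.rep (.r i) x = D.χ i * x := rfl

@[simp] lemma rep_sr (i : ZMod n) (x : K) : D.rep (.sr i) x = D.δ • D.σ (D.χ i * x) := rfl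

lemma of_smul (g : DihedralGroup n) (x : D.rep.asModule) :
    single g (1 : ℚ) • x = (D.rep g x : K) := by
  rw [Representation.single_smul, one_smul]; rfl

lemma exists_smul_eq_mul (c : K) :
    ∃ a : MonoidAlgebra ℚ (DihedralGroup n), ∀ x : K, D.rep.asAlgebraHom a x = c * x := by
  have hc : c ∈ Algebra.adjoin ℚ {D.χ 1} := by rw [D.adjoin_eq_top]; trivial
  induction hc using Algebra.adjoin_induction with
  | mem x hx =>
    rw [Set.mem_singleton_iff] at hx
    exact ⟨single (.r 1) 1, fun y ↦ by simp [hx]⟩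
  | algebraMap t => exact ⟨algebraMap _ _ t, fun y ↦ by
      rw [AlgHom.commutes, Module.algebraMap_end_apply, Algebra.smul_def]⟩
  | add x y _ _ hx hy =>
    obtain ⟨a, ha⟩ := hx
    obtain ⟨b, hb⟩ := hy
    exact ⟨a + b, fun z ↦ by rw [map_add, LinearMap.add_apply, ha, hb, add_mul]⟩
  | mul x y _ _ hx hy =>
    obtain ⟨a, ha⟩ := hx
    obtain ⟨b, hb⟩ := hy
    exact ⟨a * b, fun z ↦ by rw [map_mul, Module.End.mul_apply, ha, hb, mul_assoc]⟩

lemma nontrivial_asModule : Nontrivial D.rep.asModule := inferInstanceAs (Nontrivial K)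

instance isSimpleModule :
    IsSimpleModule (MonoidAlgebra ℚ (DihedralGroup n)) D.rep.asModule := by
  refine isSimpleModule_iff_toSpanSingleton_surjective.2 ⟨D.nontrivial_asModule, fun x hx y ↦ ?_⟩
  obtain ⟨a, ha⟩ := D.exists_smul_eq_mul (D.rep.asModuleEquiv y / D.rep.asModuleEquiv x)
  exact ⟨a, (ha x).trans (div_mul_cancel₀ _ hx)⟩

/-- Two twists whose representations are isomorphic assign the same scalar to any group element
acting on both by scalars. -/
lemma scalar_eq_of_equiv {L : Type} [Field L] [CharZero L] (E : DihedralTwist n L)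
    (f : D.rep.asModule ≃ₗ[MonoidAlgebra ℚ (DihedralGroup n)] E.rep.asModule)
    (g : DihedralGroup n) {c d : ℚ} (hc : D.rep g = c • 1) (hd : E.rep g = d • 1) :
    c = d := by
  have := D.nontrivial_asModule
  obtain ⟨x, hx⟩ := exists_ne (0 : D.rep.asModule)
  have h := f.map_smul (single g (1 : ℚ)) x
  rw [Representation.single_smul, Representation.single_smul, hc, hd, one_smul, one_smul] at h
  have h' : f (c • x) = c • f x := f.toLinearMap.map_smul_of_tower c x
  have h2 : c • f x = d • f x := h'.symm.trans h
  exact smul_left_injective ℚ (f.map_ne_zero_iff.2 hx) h2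

section Classification

variable {N : Type} [AddCommGroup N] [Module ℚ N]
  [Module (MonoidAlgebra ℚ (DihedralGroup n)) N]
  [IsScalarTower ℚ (MonoidAlgebra ℚ (DihedralGroup n)) N]

omit [IsScalarTower ℚ (MonoidAlgebra ℚ (DihedralGroup n)) N] in
lemma map_χ_apply [NeZero n] (φ : K →ₐ[ℚ] Module.End ℚ N)
    (hφ : ∀ w, φ (D.χ 1) w = single (.r 1 : DihedralGroup n) (1 : ℚ) • w) (i : ZMod n) (w : N) :
    φ (D.χ i) w = single (.r i : DihedralGroup n) (1 : ℚ) • w := by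
  have key (k : ℕ) : φ (D.χ k) w = single (.r k : DihedralGroup n) (1 : ℚ) • w := by
    induction k generalizing w with
    | zero => simp [DihedralGroup.r_zero, ← one_def]
    | succ k ih =>
      rw [Nat.cast_succ, AddChar.map_add_eq_mul, map_mul, Module.End.mul_apply, hφ, ih,
        ← mul_smul, single_mul_single, DihedralGroup.r_mul_r, one_mul]
  simpa using key i.val

lemma sr_smul_map_apply [NeZero n] (φ : K →ₐ[ℚ] Module.End ℚ N)
    (hφ : ∀ w, φ (D.χ 1) w = single (.r 1 : DihedralGroup n) (1 : ℚ) • w) (k : K) (w : N) :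
    single (.sr 0 : DihedralGroup n) (1 : ℚ) • φ k w =
      φ (D.σ k) (single (.sr 0 : DihedralGroup n) (1 : ℚ) • w) := by
  have hk : k ∈ Algebra.adjoin ℚ {D.χ 1} := by rw [D.adjoin_eq_top]; trivial
  induction hk using Algebra.adjoin_induction generalizing w with
  | mem x hx =>
    rw [Set.mem_singleton_iff] at hx
    rw [hx, D.σ_χ, D.map_χ_apply φ hφ, D.map_χ_apply φ hφ, ← mul_smul, ← mul_smul,
      single_mul_single, single_mul_single, DihedralGroup.r_mul_sr, DihedralGroup.sr_mul_r]
    simp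
  | algebraMap t =>
    rw [AlgEquiv.commutes, AlgHom.commutes, Module.algebraMap_end_apply,
      Module.algebraMap_end_apply, smul_algebra_smul_comm]
  | add x y _ _ hx hy => simp [hx, hy]
  | mul x y _ _ hx hy => simp [hx, hy]

/-- A simple module containing a nonzero vector on which `sr 0` acts by `δ` and on which the
rotations act through `K` is isomorphic to the representation of the twist. -/
lemma nonempty_equiv [NeZero n] [IsSimpleModule (MonoidAlgebra ℚ (DihedralGroup n)) N]
    (φ : K →ₐ[ℚ] Module.End ℚ N)
    (hφ : ∀ w, φ (D.χ 1) w = single (.r 1 : DihedralGroup n) (1 : ℚ) • w)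
    {v : N} (hv : v ≠ 0) (hs : single (.sr 0 : DihedralGroup n) (1 : ℚ) • v = D.δ • v) :
    Nonempty (N ≃ₗ[MonoidAlgebra ℚ (DihedralGroup n)] D.rep.asModule) := by
  let f : D.rep.asModule →ₗ[ℚ] N :=
    (LinearMap.applyₗ v ∘ₗ φ.toLinearMap) ∘ₗ D.rep.asModuleEquiv.toLinearMap
  have hf (x : K) : f x = φ x v := rfl
  have hcomm (g : DihedralGroup n) (x : D.rep.asModule) :
      f (single g (1 : ℚ) • x) = single g (1 : ℚ) • f x := by
    obtain i | i := g
    · rw [of_smul]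
      change φ (D.χ i * D.rep.asModuleEquiv x) v =
        single (.r i : DihedralGroup n) (1 : ℚ) • φ (D.rep.asModuleEquiv x) v
      rw [map_mul, Module.End.mul_apply, D.map_χ_apply φ hφ]
    · rw [of_smul]
      change φ (D.δ • D.σ (D.χ i * D.rep.asModuleEquiv x)) v =
        single (.sr i : DihedralGroup n) (1 : ℚ) • φ (D.rep.asModuleEquiv x) v
      have hi : (DihedralGroup.sr i : DihedralGroup n) = .sr 0 * .r i := by simp
      have h1 : single (.sr i : DihedralGroup n) (1 : ℚ) = single (.sr 0) 1 * single (.r i) 1 := by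
        rw [single_mul_single, ← hi, one_mul]
      rw [h1, mul_smul, ← D.map_χ_apply φ hφ, ← Module.End.mul_apply, ← map_mul,
        D.sr_smul_map_apply φ hφ, hs, map_smul, map_smul, LinearMap.smul_apply]
  let F := equivariantOfLinearOfComm f hcomm
  have hF : F ≠ 0 := fun h ↦ hv <| by
    have : F (1 : K) = φ 1 v := rfl
    rw [map_one, Module.End.one_apply] at this
    rw [← this, h]; rfl
  exact ⟨(LinearEquiv.ofBijective F (LinearMap.bijective_of_ne_zero hF)).symm⟩

end Classification

/-- The twist of `ℚ` giving the one-dimensional representation `r ↦ ε`, `s ↦ δ`. -/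
noncomputable def line (q : ℕ) [NeZero q] (ε δ : ℚ) (hε : ε * ε = 1) (hδ : δ * δ = 1) :
    DihedralTwist (2 * q) ℚ where
  χ := AddChar.zmodChar (2 * q) (ζ := ε) (by rw [pow_mul, sq, hε, one_pow])
  σ := AlgEquiv.refl
  δ := δ
  σ_σ _ := rfl
  σ_χ i := by
    rw [AddChar.map_neg_eq_inv, AlgEquiv.coe_refl, id, AddChar.zmodChar_apply]
    refine eq_inv_of_mul_eq_one_left ?_
    rw [← mul_pow, hε, one_pow]
  δ_mul_δ := hδ
  adjoin_eq_top := eq_top_iff.2 fun x _ ↦ by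
    have h (S : Subalgebra ℚ ℚ) : x ∈ S := by simpa using S.algebraMap_mem x
    exact h _

lemma line_χ_one (q : ℕ) [NeZero q] (ε δ : ℚ) (hε : ε * ε = 1) (hδ : δ * δ = 1) :
    (line q ε δ hε hδ).χ 1 = ε := by
  have : Fact (1 < 2 * q) := ⟨by have := NeZero.pos q; lia⟩
  simp [line, AddChar.zmodChar_apply, ZMod.val_one]

section Cyclotomic

variable (q : ℕ) [NeZero q] (K : Type) [Field K] [CharZero K]
  [IsCyclotomicExtension {q} ℚ K]

/-- The automorphism of the cyclotomic field inverting the roots of unity. -/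
noncomputable def cyclotomicConj : K ≃ₐ[ℚ] K :=
  IsCyclotomicExtension.fromZetaAut
    (IsCyclotomicExtension.zeta_spec q ℚ K).inv
    (Polynomial.cyclotomic.irreducible_rat (NeZero.pos q))

lemma cyclotomicConj_zeta :
    cyclotomicConj q K (IsCyclotomicExtension.zeta q ℚ K) =
      (IsCyclotomicExtension.zeta q ℚ K)⁻¹ :=
  IsCyclotomicExtension.fromZetaAut_spec _ _

lemma adjoin_zeta_eq_top :
    Algebra.adjoin ℚ {IsCyclotomicExtension.zeta q ℚ K} = ⊤ :=
  IsCyclotomicExtension.adjoin_primitive_root_eq_top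
    (IsCyclotomicExtension.zeta_spec q ℚ K)

lemma cyclotomicConj_cyclotomicConj (x : K) :
    cyclotomicConj q K (cyclotomicConj q K x) = x := by
  have h : ((cyclotomicConj q K).trans (cyclotomicConj q K) : _ →ₐ[ℚ] _) = AlgHom.id ℚ _ :=
    AlgHom.ext_of_adjoin_eq_top (adjoin_zeta_eq_top q K) (by
      rintro _ rfl
      simp [cyclotomicConj_zeta])
  exact DFunLike.congr_fun h x

/-- The twist of the cyclotomic field giving the representation in which `r` multiplies by
`ε • ζ` and `s` acts by conjugation. -/
noncomputable def cyclotomic (ε : ℚ) (hε : ε * ε = 1) :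
    DihedralTwist (2 * q) K where
  χ := AddChar.zmodChar (2 * q)
    (ζ := ε • IsCyclotomicExtension.zeta q ℚ K) (by
      rw [smul_pow, pow_mul, sq, hε, one_pow, one_smul, mul_comm, pow_mul,
        (IsCyclotomicExtension.zeta_spec q ℚ K).pow_eq_one, one_pow])
  σ := cyclotomicConj q K
  δ := 1
  σ_σ := cyclotomicConj_cyclotomicConj q K
  σ_χ i := by
    have hζ := (IsCyclotomicExtension.zeta_spec q ℚ K).ne_zero (NeZero.ne q)
    rw [AddChar.map_neg_eq_inv, AddChar.zmodChar_apply, map_pow, map_rat_smul, cyclotomicConj_zeta]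
    refine eq_inv_of_mul_eq_one_left ?_
    rw [← mul_pow, smul_mul_smul_comm, hε, inv_mul_cancel₀ hζ, one_smul, one_pow]
  δ_mul_δ := one_mul 1
  adjoin_eq_top := by
    rw [eq_top_iff, ← adjoin_zeta_eq_top q K, Algebra.adjoin_le_iff, Set.singleton_subset_iff]
    have : Fact (1 < 2 * q) := ⟨by have := NeZero.pos q; lia⟩
    rw [AddChar.zmodChar_apply, ZMod.val_one, pow_one]
    have h := Subalgebra.smul_mem _ (Algebra.self_mem_adjoin_singleton ℚ
      (ε • IsCyclotomicExtension.zeta q ℚ K)) ε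
    rwa [smul_smul, hε, one_smul] at h

lemma cyclotomic_χ_one (ε : ℚ) (hε : ε * ε = 1) :
    (cyclotomic q K ε hε).χ 1 = ε • IsCyclotomicExtension.zeta q ℚ K := by
  have : Fact (1 < 2 * q) := ⟨by have := NeZero.pos q; lia⟩
  simp [cyclotomic, AddChar.zmodChar_apply, ZMod.val_one]

end Cyclotomic


section Simple

variable {G N : Type} [Group G] [AddCommGroup N] [Module (MonoidAlgebra ℚ G) N]

/-- In a simple module, an element of the group algebra with stable kernel acts injectively or as
zero. -/
lemma smul_eq_zero_or_injective [IsSimpleModule (MonoidAlgebra ℚ G) N] (a : MonoidAlgebra ℚ G)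
    (ha : ∀ (g : G) (v : N), a • v = 0 → a • single g (1 : ℚ) • v = 0) :
    (∀ v : N, a • v = 0) ∨ ∀ v : N, a • v = 0 → v = 0 := by
  let S : Submodule (MonoidAlgebra ℚ G) N :=
    { carrier := {v | a • v = 0}
      add_mem' := fun {v w} hv hw ↦ by
        simp only [Set.mem_ofPred_eq] at *
        rw [smul_add, hv, hw, add_zero]
      zero_mem' := smul_zero a
      smul_mem' := fun x v hv ↦ by
        simp only [Set.mem_ofPred_eq] at *
        induction x using MonoidAlgebra.induction_on with
        | of g => exact ha g v hv
        | add x y hx hy => rw [add_smul, smul_add, hx, hy, add_zero]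
        | smul t x hx =>
          rw [Algebra.smul_def, mul_smul, ← mul_smul a, ← Algebra.commutes, mul_smul, hx,
            smul_zero] }
  rcases eq_bot_or_eq_top S with h | h
  · exact .inr fun v hv ↦ (Submodule.mem_bot (MonoidAlgebra ℚ G)).1 (h ▸ (show v ∈ S from hv))
  · exact .inl fun v ↦ show v ∈ S from h ▸ Submodule.mem_top

/-- In a simple module, an involution whose fixed space is stable acts as a sign. -/
lemma exists_sign_of_sq_eq_one [Module ℚ N] [IsScalarTower ℚ (MonoidAlgebra ℚ G) N]
    [IsSimpleModule (MonoidAlgebra ℚ G) N] (z : G) (hz : z * z = 1)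
    (ha : ∀ (g : G) (v : N), single z (1 : ℚ) • v = v →
      single z (1 : ℚ) • single g (1 : ℚ) • v = single g (1 : ℚ) • v) :
    ∃ ε : ℚ, (ε = 1 ∨ ε = -1) ∧ ∀ v : N, single z (1 : ℚ) • v = ε • v := by
  have hsub (v : N) : (single z (1 : ℚ) - 1) • v = 0 ↔ single z (1 : ℚ) • v = v := by
    rw [sub_smul, one_smul, sub_eq_zero]
  rcases smul_eq_zero_or_injective (N := N) (single z (1 : ℚ) - 1)
    (fun g v hv ↦ (hsub _).2 (ha g v ((hsub v).1 hv))) with h | h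
  · exact ⟨1, .inl rfl, fun v ↦ by rw [(hsub v).1 (h v), one_smul]⟩
  · refine ⟨-1, .inr rfl, fun v ↦ ?_⟩
    rw [neg_one_smul, ← add_eq_zero_iff_eq_neg]
    refine h _ ((hsub _).2 ?_)
    rw [smul_add, ← mul_smul, single_mul_single, hz, one_mul, ← one_def, one_smul, add_comm]

end Simple

section Classification

variable {q : ℕ} {N : Type} [AddCommGroup N] [Module ℚ N]
  [Module (MonoidAlgebra ℚ (DihedralGroup (2 * q))) N]
  [IsScalarTower ℚ (MonoidAlgebra ℚ (DihedralGroup (2 * q))) N]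
  [IsSimpleModule (MonoidAlgebra ℚ (DihedralGroup (2 * q))) N]

open DihedralGroup hiding one_def

/-- The central rotation by a half turn acts on a simple module as a sign. -/
lemma exists_sign_half_turn : ∃ ε : ℚ, (ε = 1 ∨ ε = -1) ∧
    ∀ v : N, single (r q : DihedralGroup (2 * q)) (1 : ℚ) • v = ε • v := by
  have hqq : (q : ZMod (2 * q)) + q = 0 := by
    rw [← Nat.cast_add, ← two_mul, ZMod.natCast_self]
  refine exists_sign_of_sq_eq_one _ (by rw [r_mul_r, hqq, r_zero]) fun g v hv ↦ ?_
  have hg : r (q : ZMod (2 * q)) * g = g * r q := by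
    rcases g with i | i
    · rw [r_mul_r, r_mul_r, add_comm]
    · rw [r_mul_sr, sr_mul_r, sub_eq_add_neg, neg_eq_of_add_eq_zero_left hqq]
  rw [← mul_smul, single_mul_single, hg, ← single_mul_single, mul_smul, hv]

omit [IsSimpleModule (MonoidAlgebra ℚ (DihedralGroup (2 * q))) N] in
lemma single_r_smul_of_eigen {ε : ℚ} {v : N}
    (hv : single (r 1 : DihedralGroup (2 * q)) (1 : ℚ) • v = ε • v) (k : ℕ) :
    single (r k : DihedralGroup (2 * q)) (1 : ℚ) • v = ε ^ k • v := by
  induction k with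
  | zero => simp [r_zero, ← one_def]
  | succ k ih =>
    have : single (r (k + 1 : ℕ) : DihedralGroup (2 * q)) (1 : ℚ) =
        single (r k) 1 * single (r 1) 1 := by
      rw [single_mul_single, r_mul_r, one_mul, Nat.cast_succ]
    rw [this, mul_smul, hv, smul_algebra_smul_comm, ih, smul_smul, pow_succ, mul_comm]

/-- The rotation `r 1` acts on a simple module as the sign `ε`, or has no `ε`-eigenvector. -/
lemma single_r_one_smul_dichotomy [NeZero q] {ε : ℚ} (hε : ε * ε = 1) :
    (∀ v : N, single (r 1 : DihedralGroup (2 * q)) (1 : ℚ) • v = ε • v) ∨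
      ∀ v : N, single (r 1 : DihedralGroup (2 * q)) (1 : ℚ) • v = ε • v → v = 0 := by
  have hsub (v : N) :
      (single (r 1 : DihedralGroup (2 * q)) (1 : ℚ) - algebraMap ℚ _ ε) • v = 0 ↔
        single (r 1 : DihedralGroup (2 * q)) (1 : ℚ) • v = ε • v := by
    rw [sub_smul, algebraMap_smul, sub_eq_zero]
  have hdich := smul_eq_zero_or_injective (N := N)
    (single (r 1 : DihedralGroup (2 * q)) (1 : ℚ) - algebraMap ℚ _ ε) fun g v hv ↦ ?_
  · simpa only [hsub] using hdich
  rw [hsub] at hv ⊢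
  rcases g with i | i
  · rw [← mul_smul, single_mul_single, r_mul_r, add_comm, ← r_mul_r, ← single_mul_single,
      mul_smul, hv, smul_algebra_smul_comm]
  · have h : (r 1 * sr i : DihedralGroup (2 * q)) = sr i * r (-1) := by
      rw [r_mul_sr, sr_mul_r, sub_eq_add_neg]
    have hinv : single (r (-1) : DihedralGroup (2 * q)) (1 : ℚ) • v = ε • v := by
      have h1 : v = ε • ε • v := by rw [smul_smul, hε, one_smul]
      conv_lhs => rw [h1, ← hv, smul_algebra_smul_comm, ← mul_smul, single_mul_single, r_mul_r]
      simp [r_zero, ← one_def]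
    rw [← mul_smul, single_mul_single, h, ← single_mul_single, mul_smul, hinv,
      smul_algebra_smul_comm]

/-- A simple module on which `r 1` acts as a sign is one-dimensional. -/
lemma exists_equiv_line [NeZero q] {ε : ℚ} (hε : ε * ε = 1)
    (hr : ∀ v : N, single (r 1 : DihedralGroup (2 * q)) (1 : ℚ) • v = ε • v) :
    ∃ (δ : ℚ) (hδ : δ * δ = 1), (δ = 1 ∨ δ = -1) ∧
      Nonempty (N ≃ₗ[MonoidAlgebra ℚ (DihedralGroup (2 * q))] (line q ε δ hε hδ).rep.asModule) := by
  obtain ⟨δ, hδ, hs⟩ := exists_sign_of_sq_eq_one (N := N) (sr 0 : DihedralGroup (2 * q))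
    (sr_mul_self 0) fun g v hv ↦ by
      have hi (i : ZMod (2 * q)) (w : N) : single (r i : DihedralGroup (2 * q)) (1 : ℚ) • w =
          ε ^ i.val • w := by
        simpa using single_r_smul_of_eigen (hr w) i.val
      rcases g with i | i
      · rw [hi, smul_algebra_smul_comm, hv]
      · have h : single (sr i : DihedralGroup (2 * q)) (1 : ℚ) =
            single (sr 0) 1 * single (r i) 1 := by simp [single_mul_single]
        rw [h, mul_smul, hi, smul_algebra_smul_comm, hv, smul_algebra_smul_comm, hv]
  have hδ' : δ * δ = 1 := by rcases hδ with rfl | rfl <;> norm_num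
  have := IsSimpleModule.nontrivial (MonoidAlgebra ℚ (DihedralGroup (2 * q))) N
  obtain ⟨v, hv⟩ := exists_ne (0 : N)
  exact ⟨δ, hδ', hδ, (line q ε δ hε hδ').nonempty_equiv (Algebra.ofId ℚ _)
    (fun w ↦ by rw [line_χ_one, hr]; rfl) hv (hs v)⟩

/-- A simple module on which `r 1` has no `ε`-eigenvector, where `ε` is the sign of the half turn,
is isomorphic to the cyclotomic field twisted by `ε`. -/
lemma nonempty_equiv_cyclotomic [Fact q.Prime] (hq2 : Odd q) (K : Type) [Field K] [CharZero K]
    [IsCyclotomicExtension {q} ℚ K] {ε : ℚ} (hε : ε * ε = 1)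
    (hrq : ∀ v : N, single (r q : DihedralGroup (2 * q)) (1 : ℚ) • v = ε • v)
    (hr : ∀ v : N, single (r 1 : DihedralGroup (2 * q)) (1 : ℚ) • v = ε • v → v = 0) :
    Nonempty (N ≃ₗ[MonoidAlgebra ℚ (DihedralGroup (2 * q))]
      (cyclotomic q K ε hε).rep.asModule) := by
  have hεq := pow_eq_self_of_odd hε hq2
  let R : Module.End ℚ N := Algebra.lsmul ℚ ℚ N (single (r 1 : DihedralGroup (2 * q)) (1 : ℚ))
  have hR (v : N) : R v = single (r 1 : DihedralGroup (2 * q)) (1 : ℚ) • v := rfl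
  let T : Module.End ℚ N := ε • R
  have hT (v : N) : T v = ε • single (r 1 : DihedralGroup (2 * q)) (1 : ℚ) • v := rfl
  have hTfix (v : N) (hv : T v = v) : v = 0 := by
    refine hr v ?_
    conv_rhs => rw [← hv, hT, smul_smul, hε, one_smul]
  have hTq : T ^ q = 1 := by
    ext v
    have h1 : R ^ q = Algebra.lsmul ℚ ℚ N (single (r q : DihedralGroup (2 * q)) (1 : ℚ)) := by
      rw [← map_pow, single_pow, r_one_pow, one_pow]
    rw [_root_.smul_pow, h1, hεq, LinearMap.smul_apply]
    change ε • single (r q : DihedralGroup (2 * q)) (1 : ℚ) • v = v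
    rw [hrq, smul_smul, hε, one_smul]
  have hΦ : Polynomial.aeval T (Polynomial.cyclotomic q ℚ) = 0 := by
    ext v
    have h := congrArg (Polynomial.aeval T) (Polynomial.cyclotomic_prime_mul_X_sub_one ℚ q)
    rw [mul_comm] at h
    simp only [map_mul, map_sub, map_pow, Polynomial.aeval_X, map_one, hTq, sub_self] at h
    refine hTfix _ (sub_eq_zero.1 ?_)
    simpa using LinearMap.congr_fun h v
  have hζ := IsCyclotomicExtension.zeta_spec q ℚ K
  have hmin : Polynomial.aeval T (minpoly ℚ (hζ.powerBasis ℚ).gen) = 0 := by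
    rw [hζ.powerBasis_gen ℚ, ← Polynomial.cyclotomic_eq_minpoly_rat hζ (NeZero.pos q), hΦ]
  obtain ⟨φ, hφζ⟩ : ∃ φ : K →ₐ[ℚ] Module.End ℚ N, φ (IsCyclotomicExtension.zeta q ℚ K) = T :=
    ⟨(hζ.powerBasis ℚ).lift T hmin, by
      simpa only [hζ.powerBasis_gen ℚ] using (hζ.powerBasis ℚ).lift_gen T hmin⟩
  obtain ⟨w, hw⟩ : ∃ w : N, w + single (sr 0 : DihedralGroup (2 * q)) (1 : ℚ) • w ≠ 0 := by
    by_contra! h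
    have hs (w : N) : single (sr 0 : DihedralGroup (2 * q)) (1 : ℚ) • w = -w :=
      (neg_eq_of_add_eq_zero_right (h w)).symm
    have hinv (w : N) : R (R w) = w := by
      have h1 : single (r (-1) : DihedralGroup (2 * q)) (1 : ℚ) • w = R w := by
        have h2 : (r (-1) : DihedralGroup (2 * q)) = sr 0 * r 1 * sr 0 := by simp
        rw [h2, ← one_mul (1 : ℚ), ← single_mul_single, ← one_mul (1 : ℚ), ← single_mul_single,
          mul_smul, mul_smul]
        simp only [one_mul, hs, smul_neg, neg_neg, hR]
      rw [← h1, hR, ← mul_smul, single_mul_single, r_mul_r]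
      simp [r_zero, ← one_def]
    have := IsSimpleModule.nontrivial (MonoidAlgebra ℚ (DihedralGroup (2 * q))) N
    obtain ⟨v, hv⟩ := exists_ne (0 : N)
    refine hv (hTfix v ?_)
    have hT2 : T ^ 2 = 1 := by
      ext w
      rw [_root_.smul_pow, sq, hε, one_smul, sq]
      exact hinv w
    obtain ⟨k, hk⟩ := hq2
    rw [hk, pow_succ, pow_mul, hT2, one_pow, one_mul] at hTq
    rw [hTq, Module.End.one_apply]
  refine (cyclotomic q K ε hε).nonempty_equiv φ (fun v ↦ ?_) hw ?_
  · rw [cyclotomic_χ_one, map_smul, hφζ, LinearMap.smul_apply, hT, smul_smul, hε, one_smul]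
  · rw [smul_add, ← mul_smul, single_mul_single, sr_mul_self, one_mul, ← one_def, one_smul,
      add_comm]
    exact (one_smul ℚ _).symm

end Classification

section Distinct

variable {q : ℕ}

/-- The representation of a twist as a rational representation of the dihedral group. -/
noncomputable def toQGModule {K : Type} [Field K] [CharZero K] (D : DihedralTwist (2 * q) K) :
    QGModule q :=
  ⟨D.rep.asModule⟩

lemma finrank_toQGModule {K : Type} [Field K] [CharZero K] (D : DihedralTwist (2 * q) K) :
    Module.finrank ℚ D.toQGModule.carrier = Module.finrank ℚ K :=
  D.rep.asModuleEquiv.finrank_eq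

lemma isSimpleModule_toQGModule {K : Type} [Field K] [CharZero K]
    (D : DihedralTwist (2 * q) K) :
    IsSimpleModule (MonoidAlgebra ℚ (DihedralGroup (2 * q))) D.toQGModule.carrier :=
  D.isSimpleModule

variable [NeZero q]

lemma finrank_line {ε δ : ℚ} (hε : ε * ε = 1) (hδ : δ * δ = 1) :
    Module.finrank ℚ (line q ε δ hε hδ).toQGModule.carrier = 1 := by
  rw [finrank_toQGModule]
  exact Module.finrank_self ℚ

lemma isEmpty_line_equiv_line {ε δ ε' δ' : ℚ} (hε : ε * ε = 1) (hδ : δ * δ = 1)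
    (hε' : ε' * ε' = 1) (hδ' : δ' * δ' = 1) (h : ε ≠ ε' ∨ δ ≠ δ') :
    IsEmpty ((line q ε δ hε hδ).toQGModule.carrier
      ≃ₗ[MonoidAlgebra ℚ (DihedralGroup (2 * q))] (line q ε' δ' hε' hδ').toQGModule.carrier) := by
  refine ⟨fun f ↦ ?_⟩
  have hr {ε δ : ℚ} (hε : ε * ε = 1) (hδ : δ * δ = 1) :
      (line q ε δ hε hδ).rep (.r 1) = ε • 1 := by
    ext
    rw [rep_r, line_χ_one]
    rfl
  have hs {ε δ : ℚ} (hε : ε * ε = 1) (hδ : δ * δ = 1) :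
      (line q ε δ hε hδ).rep (.sr 0) = δ • 1 := by
    ext
    rw [rep_sr, AddChar.map_zero_eq_one, one_mul]
    rfl
  let D := line q ε δ hε hδ
  let E := line q ε' δ' hε' hδ'
  rcases h with h | h
  · exact h (D.scalar_eq_of_equiv E f (.r 1) (hr hε hδ) (hr hε' hδ'))
  · exact h (D.scalar_eq_of_equiv E f (.sr 0) (hs hε hδ) (hs hε' hδ'))

variable (K : Type) [Field K] [CharZero K] [IsCyclotomicExtension {q} ℚ K]

lemma finrank_cyclotomic {ε : ℚ} (hε : ε * ε = 1) :
    Module.finrank ℚ (cyclotomic q K ε hε).toQGModule.carrier = q.totient := by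
  rw [finrank_toQGModule,
    IsCyclotomicExtension.finrank K (Polynomial.cyclotomic.irreducible_rat (NeZero.pos q))]

lemma isEmpty_cyclotomic_equiv_cyclotomic (hq : Odd q) {ε ε' : ℚ} (hε : ε * ε = 1)
    (hε' : ε' * ε' = 1) (h : ε ≠ ε') :
    IsEmpty ((cyclotomic q K ε hε).toQGModule.carrier
      ≃ₗ[MonoidAlgebra ℚ (DihedralGroup (2 * q))] (cyclotomic q K ε' hε').toQGModule.carrier) := by
  refine ⟨fun f ↦ ?_⟩
  have hr {ε : ℚ} (hε : ε * ε = 1) : (cyclotomic q K ε hε).rep (.r q) = ε • 1 := by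
    refine LinearMap.ext fun x ↦ ?_
    have hζ := (IsCyclotomicExtension.zeta_spec q ℚ K).pow_eq_one
    have hχ : (cyclotomic q K ε hε).χ q = ε • 1 := by
      rw [← hζ, ← nsmul_one, AddChar.map_nsmul_eq_pow, cyclotomic_χ_one, smul_pow,
        pow_eq_self_of_odd hε hq]
    rw [rep_r, hχ, smul_one_mul]
    rfl
  let D := cyclotomic q K ε hε
  exact h (D.scalar_eq_of_equiv (cyclotomic q K ε' hε') f (.r q) (hr hε) (hr hε'))

end Distinct

end DihedralTwist

lemma QGModule.isEmpty_equiv_of_finrank_ne {q : ℕ} {M N : QGModule q}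
    (h : Module.finrank ℚ M.carrier ≠ Module.finrank ℚ N.carrier) :
    IsEmpty (M.carrier ≃ₗ[MonoidAlgebra ℚ (DihedralGroup (2 * q))] N.carrier) :=
  ⟨fun f ↦ h (f.restrictScalars ℚ).finrank_eq⟩

instance CyclotomicField.isCyclotomicExtension_rat (q : ℕ) [NeZero q] :
    IsCyclotomicExtension {q} ℚ (CyclotomicField q ℚ) := by
  rw [Subsingleton.elim DivisionRing.toRatAlgebra (CyclotomicField.algebra q ℚ)]
  exact CyclotomicField.isCyclotomicExtension q ℚ

/-- For a prime `q ≥ 5`, the dihedral group `G` of order `4q` has, up to isomorphism,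
exactly 6 irreducible rational representations (simple `ℚ[G]`-modules): four of
`ℚ`-dimension 1 and two of `ℚ`-dimension `q − 1`. -/
theorem stmt_4 (q : ℕ) (hq : q.Prime) (hq5 : 5 ≤ q) :
    ∃ M : Fin 6 → QGModule q,
      (∀ i, IsSimpleModule (MonoidAlgebra ℚ (DihedralGroup (2*q))) (M i).carrier) ∧
      (∀ i j, i ≠ j →
        IsEmpty ((M i).carrier ≃ₗ[MonoidAlgebra ℚ (DihedralGroup (2*q))] (M j).carrier)) ∧
      (∀ (N : Type) [AddCommGroup N] [Module (MonoidAlgebra ℚ (DihedralGroup (2*q))) N],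
        IsSimpleModule (MonoidAlgebra ℚ (DihedralGroup (2*q))) N →
        ∃ i, Nonempty (N ≃ₗ[MonoidAlgebra ℚ (DihedralGroup (2*q))] (M i).carrier)) ∧
      (∀ i : Fin 6, Module.finrank ℚ (M i).carrier = if (i : ℕ) < 4 then 1 else q - 1) := by
  have : Fact q.Prime := ⟨hq⟩
  have hodd : Odd q := hq.odd_of_ne_two (by lia)
  have hp : (1 : ℚ) * 1 = 1 := one_mul 1
  have hm : (-1 : ℚ) * -1 = 1 := by norm_num
  let K := CyclotomicField q ℚ
  let M : Fin 6 → QGModule q :=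
    ![(DihedralTwist.line q 1 1 hp hp).toQGModule, (DihedralTwist.line q 1 (-1) hp hm).toQGModule,
      (DihedralTwist.line q (-1) 1 hm hp).toQGModule,
      (DihedralTwist.line q (-1) (-1) hm hm).toQGModule,
      (DihedralTwist.cyclotomic q K 1 hp).toQGModule,
      (DihedralTwist.cyclotomic q K (-1) hm).toQGModule]
  have hrank (i : Fin 6) :
      Module.finrank ℚ (M i).carrier = if (i : ℕ) < 4 then 1 else q - 1 := by
    rw [← Nat.totient_prime hq]
    fin_cases i
    iterate 4 exact DihedralTwist.finrank_line _ _
    iterate 2 exact DihedralTwist.finrank_cyclotomic K _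
  have hlt (i j : Fin 6) (hij : i < j) :
      IsEmpty ((M i).carrier ≃ₗ[MonoidAlgebra ℚ (DihedralGroup (2 * q))] (M j).carrier) := by
    by_cases hr : Module.finrank ℚ (M i).carrier = Module.finrank ℚ (M j).carrier
    · rw [hrank, hrank] at hr
      fin_cases i <;> fin_cases j <;> first
        | exact absurd hij (by decide)
        | exact DihedralTwist.isEmpty_line_equiv_line _ _ _ _ (by norm_num)
        | exact DihedralTwist.isEmpty_cyclotomic_equiv_cyclotomic K hodd _ _ (by norm_num)
        | exact absurd hr (by simp; lia)
    · exact QGModule.isEmpty_equiv_of_finrank_ne hr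
  refine ⟨M, fun i ↦ ?_, fun i j hij ↦ ?_, fun N _ _ _ ↦ ?_, hrank⟩
  · fin_cases i <;> exact DihedralTwist.isSimpleModule_toQGModule _
  · rcases lt_or_gt_of_ne hij with h | h
    · exact hlt i j h
    · exact ⟨fun f ↦ (hlt j i h).false f.symm⟩
  · let : Module ℚ N :=
      Module.compHom N (algebraMap ℚ (MonoidAlgebra ℚ (DihedralGroup (2 * q))))
    have : IsScalarTower ℚ (MonoidAlgebra ℚ (DihedralGroup (2 * q))) N :=
      IsScalarTower.of_algebraMap_smul fun _ _ ↦ rfl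
    obtain ⟨ε, hε, hrq⟩ := DihedralTwist.exists_sign_half_turn (q := q) (N := N)
    have hε' : ε * ε = 1 := by rcases hε with rfl | rfl <;> norm_num
    rcases DihedralTwist.single_r_one_smul_dichotomy (q := q) (N := N) hε' with hr | hr
    · obtain ⟨δ, hδ', hδ, e⟩ := DihedralTwist.exists_equiv_line hε' hr
      rcases hε with rfl | rfl <;> rcases hδ with rfl | rfl
      exacts [⟨0, e⟩, ⟨1, e⟩, ⟨2, e⟩, ⟨3, e⟩]
    · have e := DihedralTwist.nonempty_equiv_cyclotomic hodd K hε' hrq hr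
      rcases hε with rfl | rfl
      exacts [⟨4, e⟩, ⟨5, e⟩]
end

section
/- Let q ≥ 5 be a prime, c ∈ ℂ, and let C_c = {(x,y) ∈ ℂ² : x ≠ 0 and y² = x(x^{2q} + 2c·x^q + 1)}. The maps r(x,y) = (exp(2πi/q)·x, exp(πi/q)·y) and s(x,y) = (1/x, y/x^{q+1}) restrict to bijections of C_c, and there exists an injective group homomorphism from the dihedral group of order 4q, ⟨r, s | r^{2q} = s² = (sr)² = 1⟩, into the group of permutations of C_c sending the rotation generator r to the first map and the reflection s to the second map. In particular, r has order 2q as a permutation of C_c, s has order 2, and s∘r has order 2. -/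
/-- Elements `ρ` of order `n` and `σ` of order dividing `2` with `(σ * ρ) ^ 2 = 1` define a
homomorphism from the dihedral group of order `2 * n`. -/
def DihedralGroup.homOfRelations {G : Type*} [Group G] {n : ℕ} (ρ σ : G) (hρ : orderOf ρ = n)
    (hσ : σ * σ = 1) (hσρ : σ * ρ * (σ * ρ) = 1) : DihedralGroup n →* G :=
  have zpow_eq : ∀ k l : ℤ, (k : ZMod n) = l → ρ ^ k = ρ ^ l := fun k l h => by
    rw [zpow_eq_zpow_iff_modEq, hρ]
    exact (ZMod.intCast_eq_intCast_iff k l n).1 h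
  have conj : ∀ k : ℤ, σ * ρ ^ k * σ = ρ ^ (-k) := fun k => by
    have hinv : σ⁻¹ = σ := inv_eq_of_mul_eq_one_right hσ
    have h : σ * ρ * σ⁻¹ = ρ⁻¹ := by
      rw [hinv, eq_inv_iff_mul_eq_one, ← hσρ]
      group
    calc σ * ρ ^ k * σ = (σ * ρ * σ⁻¹) ^ k := by rw [conj_zpow, hinv]
      _ = ρ ^ (-k) := by rw [h, inv_zpow']
  MonoidHom.mk'
    (fun
      | .r i => ρ ^ (i.cast : ℤ)
      | .sr i => σ * ρ ^ (i.cast : ℤ))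
    (by
      have conj' : ∀ k : ℤ, ρ ^ k * σ = σ * ρ ^ (-k) := fun k => by
        rw [← conj k, ← mul_assoc, ← mul_assoc, hσ, one_mul]
      rintro (i | i) (j | j)
      · rw [DihedralGroup.r_mul_r]
        change ρ ^ _ = ρ ^ _ * ρ ^ _
        rw [← zpow_add]
        exact zpow_eq _ _ (by simp)
      · rw [DihedralGroup.r_mul_sr]
        change σ * ρ ^ _ = ρ ^ _ * (σ * ρ ^ _)
        rw [← mul_assoc, conj', mul_assoc, ← zpow_add]
        exact congrArg _ (zpow_eq _ _ (by simp; ring))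
      · rw [DihedralGroup.sr_mul_r]
        change σ * ρ ^ _ = σ * ρ ^ _ * ρ ^ _
        rw [mul_assoc, ← zpow_add]
        exact congrArg _ (zpow_eq _ _ (by simp))
      · rw [DihedralGroup.sr_mul_sr]
        change ρ ^ _ = σ * ρ ^ _ * (σ * ρ ^ _)
        rw [← mul_assoc, conj, ← zpow_add]
        exact zpow_eq _ _ (by simp; ring))

/-- If `ρ` has order `n > 2`, `σ ^ 2 = 1` and `(σ * ρ) ^ 2 = 1`, then `ρ` and `σ` generate a
dihedral group of order `2 * n`. -/
theorem DihedralGroup.exists_injective_hom {G : Type*} [Group G] {n : ℕ} (hn : 2 < n) {ρ σ : G}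
    (hρ : orderOf ρ = n) (hσ : σ * σ = 1) (hσρ : σ * ρ * (σ * ρ) = 1) :
    ∃ φ : DihedralGroup n →* G, Function.Injective φ ∧
      φ (DihedralGroup.r 1) = ρ ∧ φ (DihedralGroup.sr 0) = σ := by
  have zpow_eq_one : ∀ i : ZMod n, ρ ^ (i.cast : ℤ) = 1 → i = 0 := fun i hi => by
    rw [← orderOf_dvd_iff_zpow_eq_one, hρ, ← ZMod.intCast_zmod_eq_zero_iff_dvd] at hi
    simpa using hi
  refine ⟨homOfRelations ρ σ hρ hσ hσρ, (injective_iff_map_eq_one _).2 ?_, ?_, ?_⟩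
  · rintro (i | i) hi
    · rw [zpow_eq_one i hi, DihedralGroup.r_zero]
    · exfalso
      have hi' : σ * ρ ^ (i.cast : ℤ) = 1 := hi
      have hcomm : Commute σ ρ := by
        rw [eq_inv_of_mul_eq_one_left hi']
        exact ((Commute.refl ρ).zpow_left _).inv_left
      have hρ2 : ρ ^ 2 = 1 := by
        rw [← hσρ, ← pow_two (σ * ρ), hcomm.mul_pow, pow_two σ, hσ, one_mul]
      have := Nat.le_of_dvd two_pos (orderOf_dvd_of_pow_eq_one hρ2)
      omega
  · change ρ ^ ((1 : ZMod n).cast : ℤ) = ρ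
    conv_rhs => rw [← zpow_one ρ]
    rw [zpow_eq_zpow_iff_modEq, hρ, ← ZMod.intCast_eq_intCast_iff]
    simp
  · change σ * ρ ^ ((0 : ZMod n).cast : ℤ) = σ
    simp

/-- The affine curve `y² = x(x^(2q) + 2c·x^q + 1)` contains a point with `y ≠ 0`. -/
theorem exists_snd_ne_zero_of_hyperelliptic {q : ℕ} (hq : q ≠ 0) (c : ℂ) :
    ∃ x y : ℂ, x ≠ 0 ∧ y ≠ 0 ∧ y ^ 2 = x * (x ^ (2 * q) + 2 * c * x ^ q + 1) := by
  obtain ⟨x, hx, hxc⟩ : ∃ x : ℂ, x ≠ 0 ∧ x ^ (2 * q) + 2 * c * x ^ q + 1 ≠ 0 := by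
    by_cases hc : c = -1
    · refine ⟨2, two_ne_zero, ?_⟩
      have h : (2 : ℂ) ^ q ≠ 1 := by exact_mod_cast (Nat.one_lt_two_pow hq).ne'
      have : (2 : ℂ) ^ (2 * q) + 2 * c * 2 ^ q + 1 = (2 ^ q - 1) ^ 2 := by
        rw [hc]; ring
      rw [this]
      exact pow_ne_zero 2 (sub_ne_zero.2 h)
    · refine ⟨1, one_ne_zero, fun h => hc ?_⟩
      simp only [one_pow] at h
      linear_combination h / 2
  obtain ⟨y, hy⟩ :=
    IsAlgClosed.exists_pow_nat_eq (x * (x ^ (2 * q) + 2 * c * x ^ q + 1)) two_pos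
  refine ⟨x, y, hx, ?_, hy⟩
  rintro rfl
  exact mul_ne_zero hx hxc (by simpa using hy.symm)


/-- For a prime `q ≥ 5` and `c ∈ ℂ`, on the affine curve
`C_c = {(x,y) : x ≠ 0, y² = x(x^(2q) + 2c·x^q + 1)}`, the maps
`r(x,y) = (exp(2πi/q)x, exp(πi/q)y)` and `s(x,y) = (1/x, y/x^(q+1))` restrict to bijections
of `C_c`, and there is an injective homomorphism from the dihedral group of order `4q`
(Mathlib's `DihedralGroup (2*q)`) into the permutations of `C_c` sending the rotation
generator to the first map and the reflection generator to the second; in particular those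
permutations have orders `2q` and `2`, and their composite `s∘r` has order 2. -/
theorem stmt_10 (q : ℕ) (hq : q.Prime) (hq5 : 5 ≤ q) (c : ℂ) :
    let ωq : ℂ := Complex.exp (2 * (Real.pi : ℂ) * Complex.I / (q : ℂ))
    let ω2q : ℂ := Complex.exp ((Real.pi : ℂ) * Complex.I / (q : ℂ))
    let Cc : Set (ℂ × ℂ) :=
      {p | p.1 ≠ 0 ∧ p.2 ^ 2 = p.1 * (p.1 ^ (2*q) + 2 * c * p.1 ^ q + 1)}
    let F : ℂ × ℂ → ℂ × ℂ := fun p => (ωq * p.1, ω2q * p.2)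
    let S : ℂ × ℂ → ℂ × ℂ := fun p => (1 / p.1, p.2 / p.1 ^ (q+1))
    Set.BijOn F Cc Cc ∧ Set.BijOn S Cc Cc ∧
    ∃ φ : DihedralGroup (2*q) →* Equiv.Perm Cc,
      Function.Injective φ ∧
      (∀ p : Cc, ((φ (DihedralGroup.r 1)) p : ℂ × ℂ) = F (p : ℂ × ℂ)) ∧
      (∀ p : Cc, ((φ (DihedralGroup.sr 0)) p : ℂ × ℂ) = S (p : ℂ × ℂ)) ∧
      orderOf (φ (DihedralGroup.r 1)) = 2*q ∧
      orderOf (φ (DihedralGroup.sr 0)) = 2 ∧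
      orderOf (φ (DihedralGroup.sr 0) * φ (DihedralGroup.r 1)) = 2 := by
  intro ωq ω2q Cc F S
  have hq0 : q ≠ 0 := hq.ne_zero
  have hprim : IsPrimitiveRoot ω2q (2 * q) := by
    have h := Complex.isPrimitiveRoot_exp (2 * q) (by omega)
    convert h using 2
    push_cast
    field_simp
  have hω : ωq = ω2q ^ 2 := by
    rw [← Complex.exp_nat_mul]
    refine congrArg Complex.exp ?_
    push_cast
    ring
  have hωq : ωq ^ q = 1 := by rw [hω, ← pow_mul, hprim.pow_eq_one]
  have hω0 : ωq ≠ 0 := Complex.exp_ne_zero _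
  have hF : Set.MapsTo F Cc Cc := by
    rintro ⟨x, y⟩ ⟨hx, hy⟩
    refine ⟨mul_ne_zero hω0 hx, ?_⟩
    dsimp only [F] at hx hy ⊢
    rw [mul_pow, mul_pow, mul_pow, mul_comm 2 q, pow_mul ωq, hωq, ← hω, hy]
    ring
  have hS : Set.MapsTo S Cc Cc := by
    rintro ⟨x, y⟩ ⟨hx, hy⟩
    refine ⟨one_div_ne_zero hx, ?_⟩
    dsimp only [S] at hx hy ⊢
    simp only [div_pow, one_pow]
    rw [hy]
    field_simp
    ring
  have hSS : ∀ p ∈ Cc, S (S p) = p := by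
    rintro ⟨x, y⟩ ⟨hx, -⟩
    dsimp only [S] at hx ⊢
    ext
    · simp
    · simp only [div_pow, one_pow]
      field_simp
  have hSFSF : ∀ p ∈ Cc, S (F (S (F p))) = p := by
    rintro ⟨x, y⟩ ⟨hx, -⟩
    dsimp only [S, F] at hx ⊢
    ext
    · field_simp
    · simp only [mul_pow, div_pow, one_pow, pow_succ ωq, hωq]
      field_simp
      rw [hω, mul_comm]
  have hiter : ∀ k : ℕ, ∀ p, F^[k] p = (ωq ^ k * p.1, ω2q ^ k * p.2) := by
    intro k
    induction k with
    | zero => simp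
    | succ k ih =>
      intro p
      rw [Function.iterate_succ_apply', ih]
      ext <;> simp only [F] <;> ring
  have hFq : ∀ p, F^[2 * q] p = p := fun p => by
    rw [hiter, hprim.pow_eq_one, mul_comm 2 q, pow_mul, hωq]
    simp
  have hFinj : Set.InjOn F Cc := fun a _ b _ h => by
    have h' := congrArg (F^[2 * q - 1]) h
    rwa [← Function.iterate_succ_apply, ← Function.iterate_succ_apply,
      show (2 * q - 1).succ = 2 * q by omega, hFq, hFq] at h'
  have hFsurj : Set.SurjOn F Cc Cc := fun p hp => by
    refine ⟨F^[2 * q - 1] p, hF.iterate _ hp, ?_⟩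
    rw [← Function.iterate_succ_apply' F, show (2 * q - 1).succ = 2 * q by omega, hFq]
  have hFbij : Set.BijOn F Cc Cc := ⟨hF, hFinj, hFsurj⟩
  have hSbij : Set.BijOn S Cc Cc := Set.InvOn.bijOn ⟨hSS, hSS⟩ hS hS
  let ρ : Equiv.Perm Cc := hFbij.equiv
  let σ : Equiv.Perm Cc := hSbij.equiv
  have hρ_pow : ∀ (k : ℕ) (p : Cc), ((ρ ^ k) p : ℂ × ℂ) = F^[k] p := by
    intro k
    induction k with
    | zero => simp
    | succ k ih =>
      intro p
      rw [pow_succ, Equiv.Perm.mul_apply, ih, Function.iterate_succ_apply]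
      rfl
  have hρ : orderOf ρ = 2 * q := by
    refine Nat.dvd_antisymm (orderOf_dvd_of_pow_eq_one ?_) ?_
    · ext1 p
      exact Subtype.ext (by rw [hρ_pow, hFq]; rfl)
    · obtain ⟨x, y, hx, hy, hxy⟩ := exists_snd_ne_zero_of_hyperelliptic hq0 c
      refine hprim.dvd_of_pow_eq_one _ ?_
      have h := hρ_pow (orderOf ρ) ⟨(x, y), hx, hxy⟩
      rw [pow_orderOf_eq_one, hiter] at h
      exact (mul_eq_right₀ hy).1 (congrArg Prod.snd h).symm
  have hσ : σ * σ = 1 := by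
    ext1 p
    exact Subtype.ext (hSS p p.2)
  have hσρ : σ * ρ * (σ * ρ) = 1 := by
    ext1 p
    exact Subtype.ext (hSFSF p p.2)
  obtain ⟨φ, hφ, hr, hs⟩ := DihedralGroup.exists_injective_hom (by omega) hρ hσ hσρ
  refine ⟨hFbij, hSbij, φ, hφ, fun p => by rw [hr]; rfl, fun p => by rw [hs]; rfl, ?_, ?_, ?_⟩
  · rw [hr, hρ]
  · rw [orderOf_injective φ hφ, DihedralGroup.orderOf_sr]
  · rw [← map_mul, orderOf_injective φ hφ, DihedralGroup.sr_mul_r, DihedralGroup.orderOf_sr]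
end

section
/- Let q ≥ 5 be a prime and let G be the dihedral group of order 4q with presentation ⟨r, s | r^{2q} = s² = (sr)² = 1⟩. Define χ : G → ℤ by χ(1) = q, χ(r^q) = −q, χ(r^t) = 0 for all t with r^t ∉ {1, r^q}, and χ(s·r^t) = 1 if t is odd and χ(s·r^t) = −1 if t is even. Then ∑_{g ∈ G} (χ(g)² + χ(g²)) = 4q(q+1); equivalently, (1/(8q))·∑_{g ∈ G} (χ(g)² + χ(g²)) = (q+1)/2. -/
theorem DihedralGroup.sum_eq_sum_r_add_sum_sr {M : Type*} [AddCommMonoid M] {n : ℕ} [NeZero n]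
    (f : DihedralGroup n → M) : ∑ g, f g = ∑ i, f (.r i) + ∑ i, f (.sr i) := by
  rw [← Equiv.sum_comp DihedralGroup.equivSum.symm f, Fintype.sum_sum_type]
  rfl

theorem ZMod.natCast_ne_zero_two_mul {q : ℕ} (hq : 0 < q) : (q : ZMod (2 * q)) ≠ 0 := by
  rw [Ne, ZMod.natCast_eq_zero_iff]
  intro h
  have := Nat.le_of_dvd hq h
  omega

theorem ZMod.mul_two_eq_zero_iff {q : ℕ} (hq : 0 < q) (i : ZMod (2 * q)) :
    i * 2 = 0 ↔ i = 0 ∨ i = q := by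
  have : NeZero (2 * q) := ⟨by omega⟩
  constructor
  · intro h
    have hi : i = (i.val : ZMod (2 * q)) := (ZMod.natCast_zmod_val i).symm
    have hlt := ZMod.val_lt i
    have h' : ((i.val * 2 : ℕ) : ZMod (2 * q)) = 0 := by
      push_cast
      rwa [← hi]
    obtain ⟨k, hk⟩ := (ZMod.natCast_eq_zero_iff _ _).1 h'
    have hv : i.val = q * k := by linarith
    have hk2 : k < 2 := by nlinarith
    rw [hi, hv]
    interval_cases k <;> simp
  · rintro (rfl | rfl)
    · simp
    · have := ZMod.natCast_self (2 * q)
      push_cast at this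
      linear_combination this

theorem ZMod.mul_two_ne_natCast_of_odd {q : ℕ} (hq : Odd q) (i : ZMod (2 * q)) :
    i * 2 ≠ q := by
  intro h
  have h2 := congrArg (ZMod.castHom (dvd_mul_right 2 q) (ZMod 2)) h
  rw [map_mul, map_ofNat, map_natCast, (ZMod.natCast_eq_one_iff_odd).2 hq,
    show (OfNat.ofNat 2 : ZMod 2) = 0 from rfl, mul_zero] at h2
  exact zero_ne_one h2

/-- For a prime `q ≥ 5` and the dihedral group `G` of order `4q` (Mathlib's
`DihedralGroup (2*q)`), with `χ : G → ℤ` given by `χ(1) = q`, `χ(r^q) = −q`, `χ(r^t) = 0`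
for the other rotations, `χ(s·r^t) = 1` for `t` odd and `−1` for `t` even, one has
`∑_{g ∈ G} (χ(g)² + χ(g²)) = 4q(q+1)`; equivalently
`(1/(8q))·∑_{g ∈ G} (χ(g)² + χ(g²)) = (q+1)/2`. -/
theorem stmt_12 (q : ℕ) (hq : q.Prime) (hq5 : 5 ≤ q) :
    let χ : DihedralGroup (2*q) → ℤ := fun g =>
      match g with
      | DihedralGroup.r i => if i = 0 then (q : ℤ) else if i = (q : ZMod (2*q)) then -(q : ℤ) else 0
      | DihedralGroup.sr i => if i.val % 2 = 1 then 1 else -1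
    haveI : NeZero (2*q) := ⟨by omega⟩
    (∑ g : DihedralGroup (2*q), ((χ g) ^ 2 + χ (g ^ 2)) = 4 * (q : ℤ) * (q + 1)) ∧
    (1 / (8 * (q : ℚ))) *
        (∑ g : DihedralGroup (2*q), (((χ g) ^ 2 + χ (g ^ 2) : ℤ) : ℚ)) = ((q : ℚ) + 1) / 2 := by
  intro χ
  have : NeZero (2 * q) := ⟨by omega⟩
  have hq0 : (q : ZMod (2 * q)) ≠ 0 := ZMod.natCast_ne_zero_two_mul hq.pos
  have hodd : Odd q := hq.odd_of_ne_two (by omega)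
  have hr (i : ZMod (2 * q)) : χ (.r i) ^ 2 + χ (.r i ^ 2)
      = (if i = 0 then (q : ℤ) ^ 2 + q else 0) + if i = q then (q : ℤ) ^ 2 + q else 0 := by
    have h0 := ZMod.mul_two_eq_zero_iff hq.pos i
    have h1 := ZMod.mul_two_ne_natCast_of_odd hodd i
    rw [DihedralGroup.r_pow]
    simp only [χ, Nat.cast_ofNat, h0, h1, if_false]
    by_cases hi : i = 0
    · simp [hi, hq0.symm]
    · by_cases hi' : i = q <;> simp [hi, hi', hq0]
  have hs (i : ZMod (2 * q)) : χ (.sr i) ^ 2 + χ (.sr i ^ 2) = 1 + (q : ℤ) := by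
    rw [sq (DihedralGroup.sr i), DihedralGroup.sr_mul_sr, sub_self]
    simp only [χ, if_true]
    split_ifs <;> norm_num
  have key : ∑ g : DihedralGroup (2 * q), (χ g ^ 2 + χ (g ^ 2)) = 4 * (q : ℤ) * (q + 1) := by
    rw [DihedralGroup.sum_eq_sum_r_add_sum_sr]
    simp only [hr, hs, Finset.sum_add_distrib, Finset.sum_ite_eq', Finset.mem_univ, if_true,
      Finset.sum_const, Finset.card_univ, ZMod.card, nsmul_eq_mul]
    push_cast
    ring
  refine ⟨key, ?_⟩
  have hq' : (q : ℚ) ≠ 0 := Nat.cast_ne_zero.2 hq.ne_zero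
  rw [← Int.cast_sum, key]
  push_cast
  field_simp
  ring
end

section
/- Let R and S be the integer 5×5 matrices R = [[−1,0,1,−1,1],[1,1,0,1,0],[0,0,0,−1,0],[1,0,0,1,−1],[0,−2,0,1,−1]] and S = [[−1,0,1,−1,1],[0,−1,−1,1,−1],[0,0,0,−1,0],[0,0,−1,0,0],[0,0,0,0,1]]. Then: (i) R^{10} = I and R^k ≠ I for 1 ≤ k ≤ 9 (so R has order exactly 10); (ii) S² = I; (iii) S·R·S = R^{−1}; (iv) the 10×10 block-diagonal matrices diag(R, (Rᵗ)^{−1}) and diag(S, Sᵗ) belong to the integral symplectic group Sp(10, ℤ). Consequently, there is an injective group homomorphism ρ from the dihedral group of order 20, ⟨r, s | r^{10} = s² = (sr)² = 1⟩, into Sp(10, ℤ) with ρ(r) = diag(R, (Rᵗ)^{−1}) and ρ(s) = diag(S, Sᵗ). -/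
namespace DihedralGroup

variable {n : ℕ} {G : Type*} [Group G]

/-- The homomorphism `ZMod n → G`, `i ↦ a ^ i`, attached to an element with `a ^ n = 1`. -/
def rotationHom (a : G) (ha : a ^ n = 1) : ZMod n →+ Additive G :=
  ZMod.lift n ⟨zmultiplesHom (Additive G) (Additive.ofMul a), by
    simpa [← ofMul_pow] using ha⟩

theorem rotationHom_intCast (a : G) (ha : a ^ n = 1) (i : ℤ) :
    (rotationHom a ha i).toMul = a ^ i := by
  simp [rotationHom]

theorem mul_rotationHom {a b : G} (ha : a ^ n = 1) (hb : b * b = 1) (hab : b * a * b = a⁻¹)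
    (i : ZMod n) : (rotationHom a ha i).toMul * b = b * (rotationHom a ha (-i)).toMul := by
  obtain ⟨i, rfl⟩ := ZMod.intCast_surjective i
  have hb' : b⁻¹ = b := inv_eq_of_mul_eq_one_left hb
  have h : b * a ^ (-i) * b = a ^ i := by
    have h₁ : b * a * b⁻¹ = a⁻¹ := by rw [hb', hab]
    have h₂ := conj_zpow (i := -i) (a := b) (b := a)
    rw [h₁, hb'] at h₂
    rw [← h₂, inv_zpow', neg_neg]
  rw [← Int.cast_neg, rotationHom_intCast, rotationHom_intCast, ← h, mul_assoc, hb, mul_one]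

/-- The universal property of the dihedral group: the homomorphism with `r 1 ↦ a` and
`sr 0 ↦ b`, when `a ^ n = b * b = 1` and `b * a * b = a⁻¹`. -/
def lift (a b : G) (ha : a ^ n = 1) (hb : b * b = 1) (hab : b * a * b = a⁻¹) :
    DihedralGroup n →* G :=
  MonoidHom.mk'
    (fun
      | r i => (rotationHom a ha i).toMul
      | sr i => b * (rotationHom a ha i).toMul)
    (by
      rintro (i | i) (j | j)
      · simp
      · simp only [r_mul_sr]
        rw [← mul_assoc, mul_rotationHom ha hb hab, mul_assoc, ← toMul_add, ← map_add,
          neg_add_eq_sub]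
      · simp [mul_assoc]
      · simp only [sr_mul_sr]
        rw [mul_assoc, ← mul_assoc _ b, mul_rotationHom ha hb hab, ← mul_assoc, ← mul_assoc, hb,
          one_mul, ← toMul_add, ← map_add, neg_add_eq_sub])

section lift

variable {a b : G} (ha : a ^ n = 1) (hb : b * b = 1) (hab : b * a * b = a⁻¹)

theorem lift_r_intCast (i : ℤ) : lift a b ha hb hab (r i) = a ^ i :=
  rotationHom_intCast a ha i

theorem lift_sr_intCast (i : ℤ) : lift a b ha hb hab (sr i) = b * a ^ i :=
  congrArg (b * ·) (rotationHom_intCast a ha i)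

theorem lift_r_one : lift a b ha hb hab (r 1) = a := by
  simpa using lift_r_intCast ha hb hab 1

theorem lift_sr_zero : lift a b ha hb hab (sr 0) = b := by
  simpa using lift_sr_intCast ha hb hab 0

theorem lift_injective (hord : orderOf a = n) (hcomm : ¬ Commute b a) :
    Function.Injective (lift a b ha hb hab) := by
  rw [injective_iff_map_eq_one]
  rintro (i | i) hi <;> obtain ⟨i, rfl⟩ := ZMod.intCast_surjective i
  · rw [lift_r_intCast, ← orderOf_dvd_iff_zpow_eq_one, hord,
      ← ZMod.intCast_zmod_eq_zero_iff_dvd] at hi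
    rw [hi, r_zero]
  · rw [lift_sr_intCast] at hi
    rw [eq_inv_of_mul_eq_one_left hi] at hcomm
    exact absurd ((Commute.refl a).zpow_left i).inv_left hcomm

end lift

end DihedralGroup

namespace Matrix

variable {m A : Type*} [Fintype m] [DecidableEq m] [CommRing A]

/-- The block-diagonal embedding `u ↦ diag(u, (u⁻¹)ᵗ)` of the general linear group into the
symplectic matrices. -/
def diagInvTranspose : (Matrix m m A)ˣ →* (Matrix (m ⊕ m) (m ⊕ m) A)ˣ :=
  MonoidHom.toHomUnits
    { toFun := fun u => fromBlocks u.val 0 0 (u⁻¹).valᵀ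
      map_one' := by simp
      map_mul' := fun u v => by simp [fromBlocks_multiply, -coe_units_inv] }

theorem coe_diagInvTranspose (u : (Matrix m m A)ˣ) :
    (diagInvTranspose u).val = fromBlocks u.val 0 0 (u⁻¹).valᵀ := rfl

theorem diagInvTranspose_injective :
    Function.Injective (diagInvTranspose : (Matrix m m A)ˣ →* (Matrix (m ⊕ m) (m ⊕ m) A)ˣ) := by
  intro u v h
  have h' := congrArg Units.val h
  rw [coe_diagInvTranspose, coe_diagInvTranspose, fromBlocks_inj] at h'
  exact Units.ext h'.1

theorem diagInvTranspose_symplectic (u : (Matrix m m A)ˣ) :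
    (diagInvTranspose u).valᵀ * fromBlocks 0 1 (-1) 0 * (diagInvTranspose u).val =
      fromBlocks 0 1 (-1) 0 := by
  rw [coe_diagInvTranspose, fromBlocks_transpose, fromBlocks_multiply, fromBlocks_multiply]
  simp [-coe_units_inv, ← transpose_mul]

end Matrix

/-- For the explicit integer matrices `R`, `S` of the symplectic representation of the
dihedral group `D₁₀` of order 20 on genus-5 surfaces in the family `F₅`: (i) `R` has order
exactly 10; (ii) `S² = I`; (iii) `S·R·S = R⁻¹`; (iv) `diag(R,(Rᵗ)⁻¹)` and `diag(S,Sᵗ)` lie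
in `Sp(10,ℤ)` (i.e. `Pᵗ·J·P = J` with `J = [[0,I₅],[−I₅,0]]`); consequently there is an
injective homomorphism `ρ` from `DihedralGroup 10` (of order 20) into the invertible
`10×10` integer matrices, landing in `Sp(10,ℤ)`, with `ρ(r) = diag(R,(Rᵗ)⁻¹)` and
`ρ(s) = diag(S,Sᵗ)`. -/
theorem stmt_15 :
    let R : Matrix (Fin 5) (Fin 5) ℤ :=
      !![-1, 0, 1, -1, 1; 1, 1, 0, 1, 0; 0, 0, 0, -1, 0; 1, 0, 0, 1, -1; 0, -2, 0, 1, -1]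
    let S : Matrix (Fin 5) (Fin 5) ℤ :=
      !![-1, 0, 1, -1, 1; 0, -1, -1, 1, -1; 0, 0, 0, -1, 0; 0, 0, -1, 0, 0; 0, 0, 0, 0, 1]
    let J : Matrix (Fin 5 ⊕ Fin 5) (Fin 5 ⊕ Fin 5) ℤ := Matrix.fromBlocks 0 1 (-1) 0
    let ρr : Matrix (Fin 5 ⊕ Fin 5) (Fin 5 ⊕ Fin 5) ℤ :=
      Matrix.fromBlocks R 0 0 (R.transpose)⁻¹
    let ρs : Matrix (Fin 5 ⊕ Fin 5) (Fin 5 ⊕ Fin 5) ℤ := Matrix.fromBlocks S 0 0 S.transpose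
    (R ^ 10 = 1 ∧ ∀ k : ℕ, 1 ≤ k → k ≤ 9 → R ^ k ≠ 1) ∧
    S ^ 2 = 1 ∧
    S * R * S = R⁻¹ ∧
    (ρr.transpose * J * ρr = J ∧ ρs.transpose * J * ρs = J) ∧
    ∃ φ : DihedralGroup 10 →* (Matrix (Fin 5 ⊕ Fin 5) (Fin 5 ⊕ Fin 5) ℤ)ˣ,
      Function.Injective φ ∧
      (∀ g, ((φ g : (Matrix (Fin 5 ⊕ Fin 5) (Fin 5 ⊕ Fin 5) ℤ)ˣ) :
          Matrix (Fin 5 ⊕ Fin 5) (Fin 5 ⊕ Fin 5) ℤ).transpose * J *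
          ((φ g : (Matrix (Fin 5 ⊕ Fin 5) (Fin 5 ⊕ Fin 5) ℤ)ˣ) :
          Matrix (Fin 5 ⊕ Fin 5) (Fin 5 ⊕ Fin 5) ℤ) = J) ∧
      ((φ (DihedralGroup.r 1) : (Matrix (Fin 5 ⊕ Fin 5) (Fin 5 ⊕ Fin 5) ℤ)ˣ) :
          Matrix (Fin 5 ⊕ Fin 5) (Fin 5 ⊕ Fin 5) ℤ) = ρr ∧
      ((φ (DihedralGroup.sr 0) : (Matrix (Fin 5 ⊕ Fin 5) (Fin 5 ⊕ Fin 5) ℤ)ˣ) :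
          Matrix (Fin 5 ⊕ Fin 5) (Fin 5 ⊕ Fin 5) ℤ) = ρs := by
  intro R S J ρr ρs
  have hR : R ^ 10 = 1 := by decide +kernel
  have hR' : ∀ k : ℕ, 1 ≤ k → k ≤ 9 → R ^ k ≠ 1 := by
    intro k h₁ h₂
    interval_cases k <;> decide +kernel
  have hS : S * S = 1 := by decide +kernel
  have hRS : S * R * S * R = 1 := by decide +kernel
  have hcomm : S * R ≠ R * S := by decide +kernel
  let a : (Matrix (Fin 5) (Fin 5) ℤ)ˣ := Units.ofPowEqOne R 10 hR (by norm_num)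
  let b : (Matrix (Fin 5) (Fin 5) ℤ)ˣ := ⟨S, S, hS, hS⟩
  have ha : a ^ 10 = 1 := Units.ext hR
  have hb : b * b = 1 := Units.ext hS
  have hab : b * a * b = a⁻¹ := eq_inv_of_mul_eq_one_left (Units.ext hRS)
  have hord : orderOf a = 10 := by
    refine (orderOf_eq_iff (by norm_num)).2 ⟨ha, fun k hk hk₀ h => ?_⟩
    exact hR' k hk₀ (by omega) (congrArg Units.val h)
  have har : (Matrix.diagInvTranspose a).val = ρr := by
    rw [Matrix.coe_diagInvTranspose, Matrix.coe_units_inv, Matrix.transpose_nonsing_inv]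
    rfl
  have hbs : (Matrix.diagInvTranspose b).val = ρs := rfl
  refine ⟨⟨hR, hR'⟩, (pow_two S).trans hS, (Matrix.inv_eq_left_inv hRS).symm, ⟨?_, ?_⟩,
    Matrix.diagInvTranspose.comp (DihedralGroup.lift a b ha hb hab), ?_, ?_, ?_, ?_⟩
  · rw [← har]
    exact Matrix.diagInvTranspose_symplectic a
  · rw [← hbs]
    exact Matrix.diagInvTranspose_symplectic b
  · exact Matrix.diagInvTranspose_injective.comp
      (DihedralGroup.lift_injective ha hb hab hord fun h => hcomm (congrArg Units.val h.eq))
  · exact fun g => Matrix.diagInvTranspose_symplectic _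
  · rw [MonoidHom.comp_apply, DihedralGroup.lift_r_one, har]
  · rw [MonoidHom.comp_apply, DihedralGroup.lift_sr_zero, hbs]
end

section
/- Let R and S be the integer 5×5 matrices R = [[−1,0,1,−1,1],[1,1,0,1,0],[0,0,0,−1,0],[1,0,0,1,−1],[0,−2,0,1,−1]] and S = [[−1,0,1,−1,1],[0,−1,−1,1,−1],[0,0,0,−1,0],[0,0,−1,0,0],[0,0,0,0,1]], regarded as complex matrices. Then the set W = {Z ∈ M₅(ℂ) : Zᵗ = Z, R·Z·Rᵗ = Z, and S·Z·Sᵗ = Z} is a ℂ-linear subspace of the space of 5×5 complex matrices of dimension exactly 3. -/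
/-- The general symmetric matrix fixed by the group, in terms of its entries
`a = Z₀₀`, `b = Z₀₁`, `c = Z₀₄`. -/
noncomputable def invariantMatrix (a b c : ℂ) : Matrix (Fin 5) (Fin 5) ℂ :=
  !![a, b, -a - 2*b, -a/2, c;
    b, -a/8 - 3/4*b + 3/4*c, a/4 + b/2 - c/2, -a/4 - 3/2*b - c/2, -c;
    -a - 2*b, a/4 + b/2 - c/2, a/2 + b + c, a/2 + b, -a/2 - 2*b - c;
    -a/2, -a/4 - 3/2*b - c/2, a/2 + b, a/2 + b + c, a/2 + 2*b + c;
    c, -c, -a/2 - 2*b - c, a/2 + 2*b + c, a + 4*b + 4*c]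

/-- `invariantMatrix` as a linear map in its three parameters. -/
noncomputable def invariantMatrixLinear : (Fin 3 → ℂ) →ₗ[ℂ] Matrix (Fin 5) (Fin 5) ℂ where
  toFun v := invariantMatrix (v 0) (v 1) (v 2)
  map_add' v w := by
    ext i j
    fin_cases i <;> fin_cases j <;> simp [invariantMatrix] <;> ring
  map_smul' t v := by
    ext i j
    fin_cases i <;> fin_cases j <;> simp [invariantMatrix] <;> ring

theorem invariantMatrixLinear_injective : Function.Injective invariantMatrixLinear := by
  intro v w h
  have entry (i j : Fin 5) := congrFun (congrFun h i) j
  have h0 := entry 0 0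
  have h1 := entry 0 1
  have h2 := entry 0 4
  simp [invariantMatrixLinear, invariantMatrix] at h0 h1 h2
  ext i
  fin_cases i <;> assumption

/-- The rotation generator of the action on period matrices. -/
def rotationMatrix : Matrix (Fin 5) (Fin 5) ℂ :=
  !![-1, 0, 1, -1, 1; 1, 1, 0, 1, 0; 0, 0, 0, -1, 0; 1, 0, 0, 1, -1; 0, -2, 0, 1, -1]

/-- The reflection generator of the action on period matrices. -/
def reflectionMatrix : Matrix (Fin 5) (Fin 5) ℂ :=
  !![-1, 0, 1, -1, 1; 0, -1, -1, 1, -1; 0, 0, 0, -1, 0; 0, 0, -1, 0, 0; 0, 0, 0, 0, 1]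

theorem transpose_invariantMatrix (a b c : ℂ) :
    (invariantMatrix a b c).transpose = invariantMatrix a b c := by
  ext i j
  fin_cases i <;> fin_cases j <;> rfl

set_option maxHeartbeats 1000000 in
theorem rotation_mul_invariantMatrix_mul (a b c : ℂ) :
    rotationMatrix * invariantMatrix a b c * rotationMatrix.transpose = invariantMatrix a b c := by
  ext i j
  fin_cases i <;> fin_cases j <;>
    simp [rotationMatrix, invariantMatrix, Matrix.mul_apply, Fin.sum_univ_five] <;> ring

set_option maxHeartbeats 1000000 in
theorem reflection_mul_invariantMatrix_mul (a b c : ℂ) :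
    reflectionMatrix * invariantMatrix a b c * reflectionMatrix.transpose =
      invariantMatrix a b c := by
  ext i j
  fin_cases i <;> fin_cases j <;>
    simp [reflectionMatrix, invariantMatrix, Matrix.mul_apply, Fin.sum_univ_five] <;> ring

set_option maxHeartbeats 1000000 in
theorem eq_invariantMatrix {Z : Matrix (Fin 5) (Fin 5) ℂ} (hT : Z.transpose = Z)
    (hR : rotationMatrix * Z * rotationMatrix.transpose = Z)
    (hS : reflectionMatrix * Z * reflectionMatrix.transpose = Z) :
    Z = invariantMatrix (Z 0 0) (Z 0 1) (Z 0 4) := by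
  have symm (i j : Fin 5) : Z j i = Z i j := congrFun (congrFun hT i) j
  have entryR (i j : Fin 5) := congrFun (congrFun hR i) j
  have entryS (i j : Fin 5) := congrFun (congrFun hS i) j
  have r22 := entryR 2 2
  have s24 := entryS 2 4
  have r12 := entryR 1 2
  have r23 := entryR 2 3
  have r24 := entryR 2 4
  have s04 := entryS 0 4
  have s14 := entryS 1 4
  have r02 := entryR 0 2
  have r11 := entryR 1 1
  have r33 := entryR 3 3
  have r44 := entryR 4 4
  have r14 := entryR 1 4
  simp [rotationMatrix, reflectionMatrix, Matrix.mul_apply, Matrix.vecMul, dotProduct,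
    Fin.sum_univ_five, symm 0 1, symm 0 2, symm 0 3, symm 0 4, symm 1 2, symm 1 3, symm 1 4,
    symm 2 3, symm 2 4, symm 3 4] at r22 s24 r12 r23 r24 s04 s14 r02 r11 r33 r44 r14
  have z44 : Z 4 4 = Z 0 0 + 4 * Z 0 1 + 4 * Z 0 4 := by
    linear_combination -s24 + 3 * r24 + 2 * s04 - r33 + r44 + 2 * r14
  have z34 : Z 3 4 = Z 0 0 / 2 + 2 * Z 0 1 + Z 0 4 := by
    linear_combination -s24 + 3/2 * r24 + 1/2 * s04 - 1/2 * r33 + 1/2 * r44 + r14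
  have z33 : Z 3 3 = Z 0 0 / 2 + Z 0 1 + Z 0 4 := by
    linear_combination r24 + s04 + 1/2 * r11 - r33 + 1/2 * r44 + r14
  have z24 : Z 2 4 = -Z 0 0 / 2 - 2 * Z 0 1 - Z 0 4 := by
    linear_combination -3/2 * r24 - 1/2 * s04 + 1/2 * r33 - 1/2 * r44 - r14
  have z23 : Z 2 3 = Z 0 0 / 2 + Z 0 1 := by
    linear_combination -1/2 * s24 - r23 + 1/2 * r24 - 1/2 * r11
  have z22 : Z 2 2 = Z 0 0 / 2 + Z 0 1 + Z 0 4 := by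
    linear_combination -r22 + r24 + s04 + 1/2 * r11 - r33 + 1/2 * r44 + r14
  have z14 : Z 1 4 = -Z 0 4 := by
    linear_combination -1/2 * s04 - 1/2 * s14
  have z13 : Z 1 3 = -Z 0 0 / 4 - 3 / 2 * Z 0 1 - Z 0 4 / 2 := by
    linear_combination 1/2 * s24 - 1/2 * r24 + 1/4 * r11 - 1/4 * r44 - 1/2 * r14
  have z12 : Z 1 2 = Z 0 0 / 4 + Z 0 1 / 2 - Z 0 4 / 2 := by
    linear_combination -r12 - 1/2 * r24 - 1/2 * s04 - 3/4 * r11 + 1/2 * r33 - 1/4 * r44 - 1/2 * r14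
  have z11 : Z 1 1 = -Z 0 0 / 8 - 3 / 4 * Z 0 1 + 3 / 4 * Z 0 4 := by
    linear_combination 1/2 * s04 + 1/2 * s14 + 1/8 * r11 + 1/8 * r44 - 1/4 * r14
  have z03 : Z 0 3 = -Z 0 0 / 2 := by
    linear_combination -1/2 * s24 - 1/2 * s04 + 1/2 * r33
  have z02 : Z 0 2 = -Z 0 0 - 2 * Z 0 1 := by
    linear_combination s24 + r23 - r24 - r02 + r11
  ext i j
  fin_cases i <;> fin_cases j <;>
    simp [invariantMatrix, symm 0 1, symm 0 2, symm 0 3, symm 0 4, symm 1 2, symm 1 3, symm 1 4,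
      symm 2 3, symm 2 4, symm 3 4] <;> assumption

/-- For the explicit matrices `R`, `S` (over `ℂ`) of the symplectic representation of the
dihedral group `D₁₀` of order 20 acting on genus-5 surfaces of the family `F₅`, the set
`W = {Z : Zᵗ = Z, R·Z·Rᵗ = Z, S·Z·Sᵗ = Z}` of invariant symmetric matrices is a `ℂ`-linear
subspace of the `5×5` complex matrices of dimension exactly 3. -/
theorem stmt_16 :
    let R : Matrix (Fin 5) (Fin 5) ℂ :=
      !![-1, 0, 1, -1, 1; 1, 1, 0, 1, 0; 0, 0, 0, -1, 0; 1, 0, 0, 1, -1; 0, -2, 0, 1, -1]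
    let S : Matrix (Fin 5) (Fin 5) ℂ :=
      !![-1, 0, 1, -1, 1; 0, -1, -1, 1, -1; 0, 0, 0, -1, 0; 0, 0, -1, 0, 0; 0, 0, 0, 0, 1]
    ∃ W : Submodule ℂ (Matrix (Fin 5) (Fin 5) ℂ),
      (W : Set (Matrix (Fin 5) (Fin 5) ℂ)) =
        {Z | Z.transpose = Z ∧ R * Z * R.transpose = Z ∧ S * Z * S.transpose = Z} ∧
      Module.finrank ℂ W = 3 := by
  intro R S
  refine ⟨LinearMap.range invariantMatrixLinear, ?_, ?_⟩
  · ext Z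
    constructor
    · rintro ⟨v, rfl⟩
      exact ⟨transpose_invariantMatrix _ _ _, rotation_mul_invariantMatrix_mul _ _ _,
        reflection_mul_invariantMatrix_mul _ _ _⟩
    · rintro ⟨hT, hR, hS⟩
      exact ⟨![Z 0 0, Z 0 1, Z 0 4], (eq_invariantMatrix hT hR hS).symm⟩
  · rw [LinearMap.finrank_range_of_inj invariantMatrixLinear_injective]
    simp
end
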